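/- Let A_{n,(n_0,n_1,…,n_r)}^{(l_0,l_1,…,l_r)} be a linear Nakayama algebra with almost separate relations. If l_i = 2 for some 0 ≤ i ≤ r, then A_{n,(n_0,…,n_i,…,n_r)}^{(l_0,…,l_i,…,l_r)} is derived equivalent to A_{n,(n_0,…,n_{i−1},n_{i+1},…,n_r)}^{(l_0,…,l_{i−1},l_{i+1},…,l_r)}, the algebra obtained by deleting the i-th relation (interpreted as the hereditary path algebra kA_n when r = 0). -/

import Mathlib

open CategoryTheory

/-- A finite quiver: a finite vertex type, an arrow type, and source/target maps. -/
structure PreQuiver where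
  V : Type
  A : Type
  [fintV : Fintype V]
  s : A → V
  t : A → V

attribute [instance] PreQuiver.fintV

/-- The defining relations presenting the path algebra of the quiver `Q` over `k`, together
with the zero relations given by the paths (lists of composable arrows) in `R`.  The
generators are the trivial paths `Sum.inl v` (one for each vertex) and the arrows
`Sum.inr a`; multiplication of generators corresponds to concatenation of paths, so that the
resulting algebra has as a basis the paths of `Q` (not passing through a relation of `R`). -/
inductive PathAlgRel (k : Type) [Field k] (Q : PreQuiver) (R : Set (List Q.A)) :
    FreeAlgebra k (Q.V ⊕ Q.A) → FreeAlgebra k (Q.V ⊕ Q.A) → Prop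
  | idem (v : Q.V) :
      PathAlgRel k Q R (FreeAlgebra.ι k (Sum.inl v) * FreeAlgebra.ι k (Sum.inl v))
        (FreeAlgebra.ι k (Sum.inl v))
  | orth (v w : Q.V) (h : v ≠ w) :
      PathAlgRel k Q R (FreeAlgebra.ι k (Sum.inl v) * FreeAlgebra.ι k (Sum.inl w)) 0
  | unit :
      PathAlgRel k Q R (∑ v : Q.V, FreeAlgebra.ι k (Sum.inl v)) 1
  | source (a : Q.A) :
      PathAlgRel k Q R (FreeAlgebra.ι k (Sum.inl (Q.s a)) * FreeAlgebra.ι k (Sum.inr a))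
        (FreeAlgebra.ι k (Sum.inr a))
  | target (a : Q.A) :
      PathAlgRel k Q R (FreeAlgebra.ι k (Sum.inr a) * FreeAlgebra.ι k (Sum.inl (Q.t a)))
        (FreeAlgebra.ι k (Sum.inr a))
  | zeroRel (p : List Q.A) (hp : p ∈ R) :
      PathAlgRel k Q R ((p.map fun a => FreeAlgebra.ι k (Sum.inr a)).prod) 0

/-- The path algebra of the quiver `Q` over the field `k`, modulo the two-sided ideal
generated by the zero relations in `R`. -/
abbrev PathAlgebraRel (k : Type) [Field k] (Q : PreQuiver) (R : Set (List Q.A)) : Type :=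
  RingQuot (PathAlgRel k Q R)

/-- The path algebra of the quiver `Q` over the field `k`. -/
abbrev PathAlgebra (k : Type) [Field k] (Q : PreQuiver) : Type :=
  PathAlgebraRel k Q ∅

noncomputable instance (C : Type*) [Category C] [Abelian C] : HasDerivedCategory C :=
  HasDerivedCategory.standard C

/-- Two `k`-algebras are *derived equivalent* if there is a triangulated equivalence between
the derived categories of their categories of right modules (i.e. of left modules over the
opposite rings). -/
def DerivedEquivalent (k : Type) [Field k] (A : Type) [Ring A] [Algebra k A]
    (B : Type) [Ring B] [Algebra k B] : Prop :=
  ∃ (F : DerivedCategory (ModuleCat.{0} Aᵐᵒᵖ) ⥤ DerivedCategory (ModuleCat.{0} Bᵐᵒᵖ))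
    (c : F.CommShift ℤ), haveI := c; (F.IsTriangulated ∧ F.IsEquivalence)

/-- The linearly ordered quiver `A_n` of Dynkin type `A`, with vertices `1, …, n`
(realized as `Fin n`) and an arrow from each vertex to the next one. -/
def linQuiver (n : ℕ) : PreQuiver where
  V := Fin n
  A := Fin (n - 1)
  s := fun a => ⟨a.1, by have := a.2; omega⟩
  t := fun a => ⟨a.1 + 1, by have := a.2; omega⟩

/-- The path of length `l` in the quiver `A_n` starting at the (1-indexed) vertex `v`. -/
def linPath (n : ℕ) (v l : ℕ) : List (linQuiver n).A :=
  (List.range l).filterMap fun j =>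
    if h : v - 1 + j < n - 1 then some ⟨v - 1 + j, h⟩ else none

/-- The linear Nakayama algebra `A_{n,(n_0,…,n_{t-1})}^{(l_0,…,l_{t-1})}`: the quotient of
the path algebra of `A_n` over `k` by the two-sided ideal generated, for each `i`, by the
path of length `ls i` starting at the vertex `ns i`. -/
abbrev NakayamaAlgebra (k : Type) [Field k] (n t : ℕ) (ns ls : Fin t → ℕ) : Type :=
  PathAlgebraRel k (linQuiver n) {p | ∃ i : Fin t, p = linPath n (ns i) (ls i)}

/-- The hypotheses on the data of a linear Nakayama algebra
`A_{n,(n_0,…,n_{t-1})}^{(l_0,…,l_{t-1})}` with almost separate relations: each relation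
starts at a vertex `ns i ≥ 1` and has length `ls i ≥ 2`, the start vertices are strictly
increasing, the end vertices `ns i + ls i` are strictly increasing and at most `n`, and the
overlap of two relations is at most one arrow (`ns j ≥ ns i + ls i - 1` for `i < j`). -/
structure IsASNakayama (n t : ℕ) (ns ls : Fin t → ℕ) : Prop where
  one_le : ∀ i, 1 ≤ ns i
  two_le : ∀ i, 2 ≤ ls i
  start_lt : ∀ i j, i < j → ns i < ns j
  end_lt : ∀ i j, i < j → ns i + ls i < ns j + ls j
  end_le : ∀ i, ns i + ls i ≤ n
  almost_separate : ∀ i j, i < j → ns i + ls i ≤ ns j + 1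

section
open CategoryTheory Limits Pretriangulated

theorem triEquiv_of_loc {T D₁ D₂ : Type*} [Category T] [Category D₁] [Category D₂]
    [HasShift T ℤ] [HasShift D₁ ℤ] [HasShift D₂ ℤ]
    [HasZeroObject T] [HasZeroObject D₁] [HasZeroObject D₂]
    [Preadditive T] [Preadditive D₁] [Preadditive D₂]
    [∀ n : ℤ, (shiftFunctor T n).Additive] [∀ n : ℤ, (shiftFunctor D₁ n).Additive]
    [∀ n : ℤ, (shiftFunctor D₂ n).Additive]
    [Pretriangulated T] [Pretriangulated D₁] [Pretriangulated D₂]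
    (L₁ : T ⥤ D₁) (L₂ : T ⥤ D₂) [L₁.CommShift ℤ] [L₂.CommShift ℤ]
    [L₁.IsTriangulated] [L₂.IsTriangulated]
    (W : MorphismProperty T) [W.IsCompatibleWithShift ℤ]
    [L₁.IsLocalization W] [L₂.IsLocalization W] [L₁.mapArrow.EssSurj] :
    ∃ (F : D₁ ⥤ D₂) (c : F.CommShift ℤ), haveI := c; F.IsTriangulated ∧ F.IsEquivalence := by
  let F := (Localization.uniq L₁ L₂ W).functor
  let c₀ : Localization.Lifting L₁ W L₂ F := ⟨Localization.compUniqFunctor L₁ L₂ W⟩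
  let c : F.CommShift ℤ := Functor.commShiftOfLocalization L₁ W ℤ L₂ F
  refine ⟨F, c, ?_, ?_⟩
  · let := c
    have : NatTrans.CommShift (Localization.Lifting.iso L₁ W L₂ F).hom ℤ := inferInstance
    exact Functor.isTriangulated_of_precomp_iso (Localization.Lifting.iso L₁ W L₂ F)
  · exact (Localization.uniq L₁ L₂ W).isEquivalence_functor

section
variable {C₁ C₂ : Type*} [Category C₁] [Category C₂]
  {W₁ : MorphismProperty C₁} {W₂ : MorphismProperty C₂}
open Functor

lemma isLocalizedEquivalence_of_counit (Φ : LocalizerMorphism W₁ W₂) (Ψ : LocalizerMorphism W₂ W₁)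
    (ε₁ : Φ.functor ⋙ Ψ.functor ⟶ 𝟭 C₁) (ε₂ : Ψ.functor ⋙ Φ.functor ⟶ 𝟭 C₂)
    (hε₁ : ∀ X₁, W₁ (ε₁.app X₁)) (hε₂ : ∀ X₂, W₂ (ε₂.app X₂)) :
    Φ.IsLocalizedEquivalence where
  isEquivalence := by
    have : IsIso (whiskerRight ε₁ W₁.Q) := by
      rw [NatTrans.isIso_iff_isIso_app]
      exact fun _ ↦ Localization.inverts W₁.Q W₁ _ (hε₁ _)
    have : IsIso (whiskerRight ε₂ W₂.Q) := by
      rw [NatTrans.isIso_iff_isIso_app]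
      exact fun _ ↦ Localization.inverts W₂.Q W₂ _ (hε₂ _)
    refine (Localization.equivalence W₁.Q W₁ W₂.Q W₂ (Φ.functor ⋙ W₂.Q)
      (Φ.localizedFunctor W₁.Q W₂.Q)
      (Ψ.functor ⋙ W₁.Q) (Ψ.localizedFunctor W₂.Q W₁.Q) ?_ ?_).isEquivalence_functor
    · exact Functor.associator _ _ _ ≪≫
        isoWhiskerLeft _ (CatCommSq.iso Ψ.functor W₂.Q W₁.Q _).symm ≪≫
        (Functor.associator _ _ _).symm ≪≫
        (asIso (whiskerRight ε₁ W₁.Q)) ≪≫ Functor.leftUnitor _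
    · exact Functor.associator _ _ _ ≪≫
        isoWhiskerLeft _ (CatCommSq.iso Φ.functor W₁.Q W₂.Q _).symm ≪≫
        (Functor.associator _ _ _).symm ≪≫
        (asIso (whiskerRight ε₂ W₂.Q)) ≪≫ Functor.leftUnitor _

lemma isLocalizedEquivalence_of_left_res (Φ : LocalizerMorphism W₁ W₂)
    {ρ : C₂ ⥤ C₁} (i : ρ ⋙ Φ.functor ⟶ 𝟭 C₂) (hi : ∀ X₂, W₂ (i.app X₂))
    (hW₁ : W₁ = W₂.inverseImage Φ.functor) [Φ.functor.Full] [Φ.functor.Faithful]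
    [W₂.HasTwoOutOfThreeProperty] : Φ.IsLocalizedEquivalence := by
  refine isLocalizedEquivalence_of_counit Φ ⟨ρ, ?_⟩
    (((whiskeringRight C₁ C₁ C₂).obj Φ.functor).preimage (X := Φ.functor ⋙ ρ) (Y := 𝟭 C₁)
      (whiskerLeft Φ.functor i)) i ?_ hi
  · intro X Y f hf
    have := i.naturality f
    dsimp at this
    rw [hW₁]
    simp only [MorphismProperty.inverseImage_iff]
    rw [← W₂.postcomp_iff _ _ (hi Y), this]
    exact W₂.comp_mem _ _ (hi X) hf
  · intro X
    have := NatTrans.congr_app (((whiskeringRight C₁ C₁ C₂).obj Φ.functor).map_preimage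
      (X := Φ.functor ⋙ ρ) (Y := 𝟭 C₁) (whiskerLeft Φ.functor i)) X
    dsimp at this
    refine hW₁.ge _ ?_
    simp only [MorphismProperty.inverseImage_iff]
    exact this ▸ hi _
end

set_option linter.unusedSectionVars false
section
variable {𝓔 𝒜 : Type*} [Category 𝓔] [Category 𝒜] [Preadditive 𝓔] [HasZeroObject 𝓔]
  [HasBinaryBiproducts 𝓔] [Abelian 𝒜] [HasDerivedCategory 𝒜] (p : 𝓔 ⥤ 𝒜) [p.Additive]

/-- morphisms of complexes which become quasi-isomorphisms -/
def WC : MorphismProperty (CochainComplex 𝓔 ℤ) :=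
  (HomologicalComplex.quasiIso 𝒜 (ComplexShape.up ℤ)).inverseImage
    (p.mapHomologicalComplex (ComplexShape.up ℤ))

def WK : MorphismProperty (HomotopyCategory 𝓔 (ComplexShape.up ℤ)) :=
  (HomotopyCategory.quasiIso 𝒜 (ComplexShape.up ℤ)).inverseImage
    (p.mapHomotopyCategory (ComplexShape.up ℤ))

/-- localizer morphism -/
def PhiC : LocalizerMorphism (WC p) (HomologicalComplex.quasiIso 𝒜 (ComplexShape.up ℤ)) where
  functor := p.mapHomologicalComplex (ComplexShape.up ℤ)
  map := le_rfl

lemma WK_quotient_map_iff {X Y : CochainComplex 𝓔 ℤ} (g : X ⟶ Y) :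
    WK p ((HomotopyCategory.quotient _ _).map g) ↔ WC p g := by
  have h := HomotopyCategory.quotient_map_mem_quasiIso_iff
    ((p.mapHomologicalComplex (ComplexShape.up ℤ)).map g)
  exact h

instance : (WK p).RespectsIso := by
  unfold WK; infer_instance

lemma WK_eq : WK p = (WC p).map (HomotopyCategory.quotient _ _) := by
  apply le_antisymm
  · intro X Y f hf
    obtain ⟨X, rfl⟩ := HomotopyCategory.quotient_obj_surjective X
    obtain ⟨Y, rfl⟩ := HomotopyCategory.quotient_obj_surjective Y
    obtain ⟨g, rfl⟩ := (HomotopyCategory.quotient _ _).map_surjective f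
    exact MorphismProperty.map_mem_map _ _ _ ((WK_quotient_map_iff p g).1 hf)
  · rw [MorphismProperty.map_le_iff]
    intro X Y f hf
    exact (WK_quotient_map_iff p f).2 hf

instance : (WK p).IsCompatibleWithShift ℤ where
  condition a := by
    ext X Y f
    have e := (p.mapHomotopyCategory (ComplexShape.up ℤ)).commShiftIso a
    have h := (HomotopyCategory.quasiIso 𝒜 (ComplexShape.up ℤ)).arrow_mk_iso_iff
      (((Functor.mapArrowFunctor _ _).mapIso
        ((p.mapHomotopyCategory (ComplexShape.up ℤ)).commShiftIso a)).app (Arrow.mk f))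
    refine Iff.trans h ?_
    exact MorphismProperty.IsCompatibleWithShift.iff
      (HomotopyCategory.quasiIso 𝒜 (ComplexShape.up ℤ)) _ a

lemma isLoc_K [(PhiC p).IsLocalizedEquivalence] :
    (p.mapHomotopyCategory (ComplexShape.up ℤ) ⋙ DerivedCategory.Qh).IsLocalization (WK p) := by
  have h1 : (p.mapHomologicalComplex (ComplexShape.up ℤ) ⋙ DerivedCategory.Q).IsLocalization
    (WC p) := inferInstanceAs (((PhiC p).functor ⋙ DerivedCategory.Q).IsLocalization _)
  have h2 : (HomotopyCategory.quotient 𝓔 (ComplexShape.up ℤ) ⋙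
      (p.mapHomotopyCategory (ComplexShape.up ℤ) ⋙ DerivedCategory.Qh)).IsLocalization (WC p) :=
    Functor.IsLocalization.of_iso _ (show _ ≅ _ from
      (Functor.isoWhiskerLeft _ (DerivedCategory.quotientCompQhIso 𝒜)).symm ≪≫
      (Functor.associator _ _ _).symm ≪≫
      Functor.isoWhiskerRight (p.mapHomotopyCategoryFactors _).symm _ ≪≫
      (Functor.associator _ _ _))
  refine Functor.IsLocalization.of_comp (HomotopyCategory.quotient 𝓔 (ComplexShape.up ℤ)) _
    (HomologicalComplex.homotopyEquivalences _ _) (WK p) (WC p) ?_ (WK_eq p)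
  intro X Y f hf
  obtain ⟨e, rfl⟩ := hf
  have := homotopyEquivalences_le_quasiIso 𝒜 (ComplexShape.up ℤ)
    _ ⟨p.mapHomotopyEquiv e, rfl⟩
  exact this


lemma WK_eq_trW : WK p = ((HomotopyCategory.subcategoryAcyclic 𝒜).inverseImage
    (p.mapHomotopyCategory (ComplexShape.up ℤ))).trW := by
  ext X Y f
  rw [ObjectProperty.inverseImage_trW_iff, ← HomotopyCategory.quasiIso_eq_trW_subcategoryAcyclic]
  rfl

lemma essSurj_arrow (ρ : CochainComplex 𝒜 ℤ ⥤ CochainComplex 𝓔 ℤ)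
    (i : ρ ⋙ p.mapHomologicalComplex (ComplexShape.up ℤ) ⟶ 𝟭 _)
    (hi : ∀ X, QuasiIso (i.app X)) :
    (p.mapHomotopyCategory (ComplexShape.up ℤ) ⋙ DerivedCategory.Qh).mapArrow.EssSurj where
  mem_essImage f := by
    obtain ⟨g, ⟨e⟩⟩ := Functor.EssSurj.mem_essImage (F := (DerivedCategory.Qh (C := 𝒜)).mapArrow) f
    obtain ⟨X, Y, g⟩ := g
    obtain ⟨X, rfl⟩ := HomotopyCategory.quotient_obj_surjective X
    obtain ⟨Y, rfl⟩ := HomotopyCategory.quotient_obj_surjective Y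
    obtain ⟨g, rfl⟩ := (HomotopyCategory.quotient _ _).map_surjective g
    refine ⟨Arrow.mk ((HomotopyCategory.quotient _ _).map (ρ.map g)), ⟨?_ ≪≫ e⟩⟩
    have hX : ∀ X, IsIso (DerivedCategory.Qh.map
        ((HomotopyCategory.quotient _ _).map (i.app X))) := by
      intro X
      have := hi X
      have h := (DerivedCategory.quotientCompQhIso 𝒜).hom.naturality (i.app X)
      have : IsIso (DerivedCategory.Q.map (i.app X)) := inferInstance
      exact (NatIso.isIso_map_iff (DerivedCategory.quotientCompQhIso 𝒜) (i.app X)).2 this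
    have := hX X
    have := hX Y
    refine Arrow.isoMk (@asIso _ _ _ _ _ (hX X)) (@asIso _ _ _ _ _ (hX Y)) ?_
    have h := congr_arg (fun z => DerivedCategory.Qh.map ((HomotopyCategory.quotient _ _).map z))
      (i.naturality g)
    simp only [Functor.map_comp] at h
    exact h.symm
end

theorem abstract_equiv {𝓔 𝒜 ℬ : Type*} [Category 𝓔] [Category 𝒜] [Category ℬ]
    [Preadditive 𝓔] [HasZeroObject 𝓔] [HasBinaryBiproducts 𝓔]
    [Abelian 𝒜] [HasDerivedCategory 𝒜] [Abelian ℬ] [HasDerivedCategory ℬ]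
    (p : 𝓔 ⥤ 𝒜) [p.Additive] [p.Full] [p.Faithful]
    (q : 𝓔 ⥤ ℬ) [q.Additive] [q.Full] [q.Faithful]
    (ρ : CochainComplex 𝒜 ℤ ⥤ CochainComplex 𝓔 ℤ)
    (i : ρ ⋙ p.mapHomologicalComplex (ComplexShape.up ℤ) ⟶ 𝟭 _)
    (hi : ∀ X, QuasiIso (i.app X))
    (σ : CochainComplex ℬ ℤ ⥤ CochainComplex 𝓔 ℤ)
    (j : 𝟭 _ ⟶ σ ⋙ q.mapHomologicalComplex (ComplexShape.up ℤ))
    (hj : ∀ X, QuasiIso (j.app X))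
    (hpq : ∀ K : CochainComplex 𝓔 ℤ,
      ((p.mapHomologicalComplex (ComplexShape.up ℤ)).obj K).Acyclic ↔
      ((q.mapHomologicalComplex (ComplexShape.up ℤ)).obj K).Acyclic) :
    ∃ (F : DerivedCategory 𝒜 ⥤ DerivedCategory ℬ) (c : F.CommShift ℤ),
      haveI := c; F.IsTriangulated ∧ F.IsEquivalence := by
  have hW : WK p = WK q := by
    rw [WK_eq_trW, WK_eq_trW]
    congr 1
    ext X
    obtain ⟨X, rfl⟩ := HomotopyCategory.quotient_obj_surjective X
    refine Iff.trans (HomotopyCategory.quotient_obj_mem_subcategoryAcyclic_iff_acyclic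
      ((p.mapHomologicalComplex (ComplexShape.up ℤ)).obj X)) (Iff.trans (hpq X) ?_)
    exact (HomotopyCategory.quotient_obj_mem_subcategoryAcyclic_iff_acyclic
      ((q.mapHomologicalComplex (ComplexShape.up ℤ)).obj X)).symm
  have : (PhiC p).functor.Full :=
    inferInstanceAs (p.mapHomologicalComplex (ComplexShape.up ℤ)).Full
  have : (PhiC p).functor.Faithful :=
    inferInstanceAs (p.mapHomologicalComplex (ComplexShape.up ℤ)).Faithful
  have : (PhiC q).functor.Full :=
    inferInstanceAs (q.mapHomologicalComplex (ComplexShape.up ℤ)).Full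
  have : (PhiC q).functor.Faithful :=
    inferInstanceAs (q.mapHomologicalComplex (ComplexShape.up ℤ)).Faithful
  have h1 : (PhiC p).IsLocalizedEquivalence :=
    isLocalizedEquivalence_of_left_res (PhiC p) i hi rfl
  have h2 : (PhiC q).IsLocalizedEquivalence :=
    (PhiC q).isLocalizedEquivalence_of_functorial_right_resolutions j hj rfl
  have := isLoc_K p
  have := isLoc_K q
  rw [← hW] at this
  have := essSurj_arrow p ρ i hi
  exact triEquiv_of_loc (p.mapHomotopyCategory (ComplexShape.up ℤ) ⋙ DerivedCategory.Qh)
    (q.mapHomotopyCategory (ComplexShape.up ℤ) ⋙ DerivedCategory.Qh) (WK p)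
end

section
open CategoryTheory Limits Pretriangulated CochainComplex HomComplex

section
variable {𝒜 : Type*} [Category 𝒜] [Abelian 𝒜]

local notation "Cx" => CochainComplex 𝒜 ℤ

/-- The mapping cone as a functor. -/
noncomputable def coneFunctor {D : Type*} [Category D] {S T : D ⥤ Cx} (α : S ⟶ T) : D ⥤ Cx where
  obj K := mappingCone (α.app K)
  map f := mappingCone.map _ _ (S.map f) (T.map f) (α.naturality f).symm
  map_id K := by
    refine Eq.trans ?_ (mappingCone.map_id (α.app K))
    congr 1 <;> simp
  map_comp f g := by
    refine Eq.trans ?_ (mappingCone.map_comp _ _ _ _ _ (α.naturality f).symm _ _ (α.naturality g).symm)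
    congr 1 <;> simp

lemma quasiIso_coneMap {K₁ L₁ K₂ L₂ : Cx} (φ₁ : K₁ ⟶ L₁) (φ₂ : K₂ ⟶ L₂)
    (a : K₁ ⟶ K₂) (b : L₁ ⟶ L₂) (comm : φ₁ ≫ b = a ≫ φ₂) [QuasiIso a] [QuasiIso b] :
    QuasiIso (mappingCone.map φ₁ φ₂ a b comm) := by
  let : HasDerivedCategory 𝒜 := HasDerivedCategory.standard 𝒜
  rw [← DerivedCategory.isIso_Q_map_iff_quasiIso]
  exact isIso₃_of_isIso₁₂ (DerivedCategory.Q.mapTriangle.map (mappingCone.triangleMap φ₁ φ₂ a b comm))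
    (DerivedCategory.mappingCone_triangle_distinguished φ₁)
    (DerivedCategory.mappingCone_triangle_distinguished φ₂)
    (inferInstanceAs (IsIso (DerivedCategory.Q.map a)))
    (inferInstanceAs (IsIso (DerivedCategory.Q.map b)))

/-- descending from a mapping cone along a map killing the source -/
noncomputable def desc0 {K L X : Cx} (φ : K ⟶ L) (g : L ⟶ X) (h : φ ≫ g = 0) :
    mappingCone φ ⟶ X := mappingCone.desc φ 0 g (by simp [h])

lemma map_desc0 {K₁ L₁ K₂ L₂ X : Cx} (φ₁ : K₁ ⟶ L₁) (φ₂ : K₂ ⟶ L₂)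
    (a : K₁ ⟶ K₂) (b : L₁ ⟶ L₂) (comm : φ₁ ≫ b = a ≫ φ₂) (g : L₂ ⟶ X) (h : φ₂ ≫ g = 0)
    (g' : L₁ ⟶ X) (hg' : b ≫ g = g') :
    mappingCone.map φ₁ φ₂ a b comm ≫ desc0 φ₂ g h =
      desc0 φ₁ g' (by rw [← hg', reassoc_of% comm, h, comp_zero]) := by
  ext n
  subst hg'
  simp [mappingCone.ext_from_iff _ (n + 1) n rfl, mappingCone.map, desc0]

lemma desc0_comp {K L X Y : Cx} (φ : K ⟶ L) (g : L ⟶ X) (h : φ ≫ g = 0) (f : X ⟶ Y)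
    (g' : L ⟶ Y) (hg' : g ≫ f = g') :
    desc0 φ g h ≫ f = desc0 φ g' (by rw [← hg', reassoc_of% h, zero_comp]) := by
  ext n
  subst hg'
  simp [mappingCone.ext_from_iff _ (n + 1) n rfl, desc0]

lemma quasiIso_desc0 {K L X : Cx} (φ : K ⟶ L) (g : L ⟶ X) (h : φ ≫ g = 0)
    (hS : (ShortComplex.mk φ g h).ShortExact) : QuasiIso (desc0 φ g h) := by
  have h1 := mappingCone.quasiIso_descShortComplex hS
  have h2 : mappingCone.descShortComplex (ShortComplex.mk φ g h) = desc0 φ g h := by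
    unfold mappingCone.descShortComplex desc0
    rfl
  exact h2 ▸ h1

/-- iso of the terms of a mapping cone -/
lemma cone_X_mem (E : ObjectProperty 𝒜) [E.IsClosedUnderIsomorphisms]
    (hE : ∀ X Y, E X → E Y → E (X ⊞ Y))
    {K L : Cx} (φ : K ⟶ L) (hK : ∀ n, E (K.X n)) (hL : ∀ n, E (L.X n)) (n : ℤ) :
    E ((mappingCone φ).X n) :=
  E.prop_of_iso (HomologicalComplex.homotopyCofiber.XIsoBiprod φ n (n+1) rfl).symm
    (hE _ _ (hK _) (hL _))

variable (P₁ P₀ : 𝒜 ⥤ 𝒜) [P₁.Additive] [P₀.Additive] (ι : P₁ ⟶ P₀) (ε : P₀ ⟶ 𝟭 𝒜)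
  (hιε : ∀ M, ι.app M ≫ ε.app M = 0)

local notation "C(" P ")" => Functor.mapHomologicalComplex P (ComplexShape.up ℤ)

/-- natural transformation from complexes -/
noncomputable def epsC : C(P₀) ⟶ 𝟭 Cx :=
  { app := fun K => { f := fun _ => ε.app _, comm' := fun i j _ => (ε.naturality (K.d i j)).symm },
    naturality := fun K L f => by ext n; exact ε.naturality (f.f n) }

structure ResData where
  Z : Cx ⥤ Cx
  θ : Z ⟶ 𝟭 Cx
  qis : ∀ K, QuasiIso (θ.app K)

noncomputable def ResData.nextα (D : ResData (𝒜 := 𝒜)) : C(P₁) ⋙ D.Z ⟶ C(P₀) :=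
  { app K := D.θ.app _ ≫ (NatTrans.mapHomologicalComplex ι (ComplexShape.up ℤ)).app K
    naturality K L f := by
      have h1 := D.θ.naturality (C(P₁).map f)
      have h2 := (NatTrans.mapHomologicalComplex ι (ComplexShape.up ℤ)).naturality f
      simp only [Functor.id_map, Functor.id_obj] at h1
      simp only [Functor.comp_map, Category.assoc, ← h2, reassoc_of% h1] }

lemma iotaC_epsC (hιε : ∀ M, ι.app M ≫ ε.app M = 0) (K : Cx) :
    (NatTrans.mapHomologicalComplex ι (ComplexShape.up ℤ)).app K ≫
    (epsC P₀ ε).app K = 0 := by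
  ext n
  exact hιε _

lemma shortExactC (hse : ∀ M, (ShortComplex.mk _ _ (hιε M)).ShortExact) (K : Cx) :
    (ShortComplex.mk _ _ (iotaC_epsC P₁ P₀ ι ε hιε K)).ShortExact :=
  HomologicalComplex.shortExact_of_degreewise_shortExact _ fun i => hse (K.X i)

lemma ResData.nextα_comp (D : ResData (𝒜 := 𝒜)) (hιε : ∀ M, ι.app M ≫ ε.app M = 0) (K : Cx) :
    (D.nextα P₁ P₀ ι).app K ≫ (epsC P₀ ε).app K = 0 := by
  have := iotaC_epsC P₁ P₀ ι ε hιε K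
  simp only [nextα, Category.assoc]
  erw [this, comp_zero]

/-- the next step of the resolution -/
noncomputable def ResData.next (D : ResData (𝒜 := 𝒜))
    (hse : ∀ M, (ShortComplex.mk _ _ (hιε M)).ShortExact) : ResData (𝒜 := 𝒜) where
  Z := coneFunctor (D.nextα P₁ P₀ ι)
  θ :=
    { app K := desc0 _ ((epsC P₀ ε).app K) (D.nextα_comp P₁ P₀ ι ε hιε K)
      naturality K L f := by
        have h2 := (epsC P₀ ε).naturality f
        refine Eq.trans (map_desc0 _ _ _ _ ((D.nextα P₁ P₀ ι).naturality f).symm _ _ _ h2) (desc0_comp _ _ _ _ _ rfl).symm }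
  qis K := by
    have h1 := D.qis (C(P₁).obj K)
    have h2 := quasiIso_coneMap ((D.nextα P₁ P₀ ι).app K)
      ((NatTrans.mapHomologicalComplex ι (ComplexShape.up ℤ)).app K)
      (D.θ.app _) (𝟙 _) (by simp [nextα])
    have h3 := quasiIso_desc0 _ _ _ (shortExactC P₁ P₀ ι ε hιε hse K)
    have h4 := map_desc0 ((D.nextα P₁ P₀ ι).app K)
      ((NatTrans.mapHomologicalComplex ι (ComplexShape.up ℤ)).app K)
      (D.θ.app _) (𝟙 _) (by simp [nextα]) ((epsC P₀ ε).app K)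
      (iotaC_epsC P₁ P₀ ι ε hιε K) _ (Category.id_comp _)
    have h5 : QuasiIso (_ ≫ _) := quasiIso_comp (hφ := h2) (hφ' := h3)
    rw [h4] at h5
    exact h5

/-- the iterated resolution -/
noncomputable def resIter (hse : ∀ M, (ShortComplex.mk _ _ (hιε M)).ShortExact) :
    ℕ → ResData (𝒜 := 𝒜)
  | 0 => ⟨𝟭 _, 𝟙 _, fun K => by dsimp; infer_instance⟩
  | (m + 1) => (resIter hse m).next P₁ P₀ ι ε hιε hse

/-- the property that the iterated syzygy is in `E` -/
def syzIter (E : ObjectProperty 𝒜) : ℕ → ObjectProperty 𝒜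
  | 0 => E
  | (m + 1) => fun M => syzIter E m (P₁.obj M)

lemma resIter_mem (hse : ∀ M, (ShortComplex.mk _ _ (hιε M)).ShortExact)
    (E : ObjectProperty 𝒜) [E.IsClosedUnderIsomorphisms]
    (hE : ∀ X Y, E X → E Y → E (X ⊞ Y)) (hP : ∀ M, E (P₀.obj M)) (m : ℕ) :
    ∀ (K : Cx) (_ : ∀ n, syzIter P₁ E m (K.X n)) (n : ℤ),
      E (((resIter P₁ P₀ ι ε hιε hse m).Z.obj K).X n) := by
  induction m with
  | zero => intro K hK n; exact hK n
  | succ m ih =>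
    intro K hK n
    exact cone_X_mem E hE _ (ih (C(P₁).obj K) hK) (fun _ => hP _) n
end
end

section
open CategoryTheory Limits Pretriangulated CochainComplex HomComplex

section
variable {𝒜 : Type*} [Category 𝒜] [Abelian 𝒜]

local notation "Cx" => CochainComplex 𝒜 ℤ

/-- lifting to a mapping cocone along a map killed by the map -/
noncomputable def lift0 {K L X : Cx} (φ : K ⟶ L) (g : L ⟶ X) (h : φ ≫ g = 0) :
    K ⟶ mappingCocone g := mappingCocone.lift g φ 0 (by simp [h])

lemma cocone_inl_v {L X : Cx} (g : L ⟶ X) (p : ℤ) :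
    (mappingCocone.inl g).v p p (add_zero p) = (mappingCone.inl g).v p (p + -1) (by lia) := by
  unfold mappingCocone.inl
  refine (Cochain.rightShift_v (n := -1) _ _ _ _ p _ _ (p + -1) (by lia)).trans ?_
  exact Category.comp_id _

lemma lift0_f {K L X : Cx} (φ : K ⟶ L) (g : L ⟶ X) (h : φ ≫ g = 0) (p : ℤ) :
    (lift0 φ g h).f p = (φ.f p ≫ (mappingCone.inl g).v p (p + -1) (by lia) : K.X p ⟶ (mappingCone g).X (p + -1)) := by
  rw [← cocone_inl_v]
  rw [← Category.comp_id ((lift0 φ g h).f p), ← mappingCocone.id_X g p (p + -1) rfl, Preadditive.comp_add]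
  unfold lift0
  rw [mappingCocone.lift_f_fst_f_assoc, mappingCocone.lift_f_snd_v_assoc]
  simp only [Cochain.zero_v, zero_comp, add_zero]
  rfl

lemma sfci_f (X : Cx) (n : ℤ) : ((shiftFunctorCompIsoId _ (-1 : ℤ) 1 (by lia)).hom.app X).f n =
   (X.XIsoOfEq (by lia)).hom := by
  simp only [shiftFunctorCompIsoId, Iso.trans_hom, Iso.symm_hom, NatTrans.comp_app]
  refine (HomologicalComplex.comp_f _ _ _).trans ?_
  rw [shiftFunctorAdd'_inv_app_f', shiftFunctorZero_hom_app_f]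
  simp

lemma inl_XIso {L X : Cx} (g : L ⟶ X) (a n m : ℤ) (h1 : a + -1 = m) (h2 : a + -1 = n) (h3 : m = n) :
    (mappingCone.inl g).v a m h1 ≫ ((mappingCone g).XIsoOfEq h3).hom =
      (mappingCone.inl g).v a n h2 := by
  subst h3
  simp

/-- composite -/
noncomputable def coneC {K L X : Cx} (φ : K ⟶ L) (g : L ⟶ X) (h : φ ≫ g = 0) :
    mappingCone φ ⟶ mappingCone g := (mappingCone.triangle φ).mor₃ ≫ (lift0 φ g h)⟦(1:ℤ)⟧' ≫
      (shiftFunctorCompIsoId _ (-1 : ℤ) 1 (by lia)).hom.app (mappingCone g)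

lemma coneC_f {K L X : Cx} (φ : K ⟶ L) (g : L ⟶ X) (h : φ ≫ g = 0) (n : ℤ) :
    (coneC φ g h).f n = - (mappingCone.fst φ).1.v n (n+1) rfl ≫ φ.f (n+1) ≫
      (mappingCone.inl g).v (n+1) n (by lia) := by
  have e : (coneC φ g h).f n =
      (mappingCone.triangle φ).mor₃.f n ≫ (lift0 φ g h).f (n+1) ≫ 
       ((shiftFunctorCompIsoId _ (-1 : ℤ) 1 (by lia)).hom.app (mappingCone g)).f n := rfl
  have key : (lift0 φ g h).f (n+1) ≫
       ((shiftFunctorCompIsoId _ (-1 : ℤ) 1 (by lia)).hom.app (mappingCone g)).f n =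
       φ.f (n+1) ≫ (mappingCone.inl g).v (n+1) n (by lia) := by
    rw [lift0_f, sfci_f]
    refine (Category.assoc _ _ _).trans ?_
    congr 1
    exact inl_XIso g (n+1) n _ _ _ _
  refine e.trans ((congrArg (fun z => (mappingCone.triangle φ).mor₃.f n ≫ z) key).trans ?_)
  refine (mappingCone.ext_from_iff φ (n+1) n rfl _ _).2 ⟨?_, ?_⟩
  · refine (Category.assoc _ _ _).symm.trans ?_
    have h1 := mappingCone.inl_v_triangle_mor₃_f φ (n+1) n (by lia)
    refine (congrArg (fun z => z ≫ φ.f (n+1) ≫ (mappingCone.inl g).v (n+1) n (by lia)) h1).trans ?_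
    simp only [Preadditive.comp_neg, mappingCone.inl_v_fst_v_assoc]
    refine (Preadditive.neg_comp _ _).trans ?_
    congr 1
    exact Category.id_comp _
  · refine (Category.assoc _ _ _).symm.trans ?_
    have h1 := mappingCone.inr_f_triangle_mor₃_f φ n
    refine (congrArg (fun z => z ≫ φ.f (n+1) ≫ (mappingCone.inl g).v (n+1) n (by lia)) h1).trans ?_
    simp only [Preadditive.comp_neg, mappingCone.inr_f_fst_v_assoc, zero_comp, neg_zero]
    exact zero_comp

lemma coneC_htpy {K L X : Cx} (φ : K ⟶ L) (g : L ⟶ X) (h : φ ≫ g = 0) :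
    Nonempty (Homotopy (coneC φ g h) (desc0 φ g h ≫ mappingCone.inr g)) := by
  refine ⟨(Cochain.equivHomotopy _ _).symm ⟨- (mappingCone.snd φ).comp (mappingCone.inl g) (by lia), ?_⟩⟩
  ext n
  simp only [Cochain.ofHom_v, Cochain.add_v, coneC_f]
  rw [δ_neg, δ_comp _ _ _ (1:ℤ) 0 0 (by lia) (by lia) (by lia), mappingCone.δ_snd, mappingCone.δ_inl]
  refine (mappingCone.ext_from_iff φ (n+1) n rfl _ _).2 ⟨?_, ?_⟩
  · simp [desc0, Cochain.comp_v _ _ _ n (n+1) n rfl (by lia : n + 1 + -1 = n)]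
  · simp [desc0, Cochain.comp_v _ _ _ n (n+1) n rfl (by lia : n + 1 + -1 = n)]

lemma quasiIso_of_triangles [HasDerivedCategory 𝒜] (T T' : Triangle Cx)
    (hT : DerivedCategory.Q.mapTriangle.obj T ∈ distTriang _)
    (hT' : DerivedCategory.Q.mapTriangle.obj T' ∈ distTriang _)
    (a : T.obj₁ ⟶ T'.obj₁) (b : T.obj₂ ⟶ T'.obj₂) (c : T.obj₃ ⟶ T'.obj₃)
    (h1 : T.mor₁ ≫ b = a ≫ T'.mor₁) (h2 : T.mor₂ ≫ c = b ≫ T'.mor₂)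
    (h3 : DerivedCategory.Q.map (T.mor₃ ≫ a⟦(1:ℤ)⟧') = DerivedCategory.Q.map (c ≫ T'.mor₃))
    (hb : QuasiIso b) (hc : QuasiIso c) : QuasiIso a := by
  rw [← DerivedCategory.isIso_Q_map_iff_quasiIso] at hb hc ⊢
  have c1 : DerivedCategory.Q.map T.mor₁ ≫ DerivedCategory.Q.map b =
      DerivedCategory.Q.map a ≫ DerivedCategory.Q.map T'.mor₁ := by
    simp only [← Functor.map_comp, h1]
  have c2 : DerivedCategory.Q.map T.mor₂ ≫ DerivedCategory.Q.map c =
      DerivedCategory.Q.map b ≫ DerivedCategory.Q.map T'.mor₂ := by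
    simp only [← Functor.map_comp, h2]
  have c3 : (DerivedCategory.Q.map T.mor₃ ≫ (DerivedCategory.Q.commShiftIso (1:ℤ)).hom.app T.obj₁)
      ≫ (DerivedCategory.Q.map a)⟦(1:ℤ)⟧' =
      DerivedCategory.Q.map c ≫ (DerivedCategory.Q.map T'.mor₃ ≫
        (DerivedCategory.Q.commShiftIso (1:ℤ)).hom.app T'.obj₁) := by
    have e := (DerivedCategory.Q.commShiftIso (1:ℤ)).hom.naturality a
    rw [Functor.comp_map, Functor.comp_map] at e
    simp only [Category.assoc]
    rw [← e, ← Functor.map_comp_assoc, h3, Functor.map_comp_assoc]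
  exact isIso₁_of_isIso₂₃ (T := DerivedCategory.Q.mapTriangle.obj T)
    (T' := DerivedCategory.Q.mapTriangle.obj T')
    { hom₁ := DerivedCategory.Q.map a
      hom₂ := DerivedCategory.Q.map b
      hom₃ := DerivedCategory.Q.map c
      comm₁ := c1
      comm₂ := c2
      comm₃ := c3 } hT hT' hb hc

lemma quasiIso_lift0 {K L X : Cx} (φ : K ⟶ L) (g : L ⟶ X) (h : φ ≫ g = 0)
    [QuasiIso (desc0 φ g h)] : QuasiIso (lift0 φ g h) := by
  let : HasDerivedCategory 𝒜 := HasDerivedCategory.standard 𝒜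
  refine quasiIso_of_triangles (mappingCone.triangle φ) (mappingCocone.triangle g)
    (DerivedCategory.mappingCone_triangle_distinguished φ)
    (DerivedCategory.mappingCocone_triangle_distinguished g) (lift0 φ g h) (𝟙 L) (desc0 φ g h)
    ?_ ?_ ?_ (inferInstanceAs (QuasiIso (𝟙 L))) (by assumption)
  · exact (Category.comp_id _).trans (mappingCocone.lift_fst g φ 0 (by simp [h])).symm
  · refine Eq.trans ?_ (Category.id_comp _).symm
    exact mappingCone.inr_desc φ 0 g (by simp [h])
  · obtain ⟨ho⟩ := coneC_htpy φ g h
    let S := (shiftFunctorCompIsoId Cx (-1 : ℤ) 1 (by lia)).app (mappingCone g)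
    have e1 : coneC φ g h ≫ S.inv = (mappingCone.triangle φ).mor₃ ≫ (lift0 φ g h)⟦(1:ℤ)⟧' := by
      refine (Category.assoc _ _ _).trans ?_
      congr 1
      refine (Category.assoc _ _ _).trans ?_
      refine (congrArg (fun z => (lift0 φ g h)⟦(1:ℤ)⟧' ≫ z) S.hom_inv_id).trans ?_
      exact Category.comp_id _
    have e2 : (desc0 φ g h ≫ mappingCone.inr g) ≫ S.inv =
      desc0 φ g h ≫ (mappingCocone.triangle g).mor₃ := Category.assoc _ _ _
    have := DerivedCategory.Q_map_eq_of_homotopy 𝒜 ho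
    refine Eq.trans ?_ ((congrArg (fun z => z ≫ DerivedCategory.Q.map S.inv) this).trans ?_)
    · refine Eq.trans ?_ (Functor.map_comp _ _ _)
      exact congrArg _ e1.symm
    · refine (Functor.map_comp _ _ _).symm.trans ?_
      exact congrArg _ e2
end
end

section
open CategoryTheory Limits Pretriangulated CochainComplex HomComplex

section
variable {𝒜 : Type*} [Category 𝒜] [Abelian 𝒜]

local notation "Cx" => CochainComplex 𝒜 ℤ
local notation "C(" P ")" => Functor.mapHomologicalComplex P (ComplexShape.up ℤ)

lemma lift0_naturality {K L X K' L' X' : Cx} (φ : K ⟶ L) (g : L ⟶ X) (h : φ ≫ g = 0)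
    (φ' : K' ⟶ L') (g' : L' ⟶ X') (h' : φ' ≫ g' = 0) (a : K ⟶ K') (b : L ⟶ L') (c : X ⟶ X')
    (hab : φ ≫ b = a ≫ φ') (hbc : g ≫ c = b ≫ g') :
    a ≫ lift0 φ' g' h' = lift0 φ g h ≫ (mappingCone.map g g' b c hbc)⟦(-1:ℤ)⟧' := by
  ext p
  have e : (lift0 φ g h ≫ (mappingCone.map g g' b c hbc)⟦(-1:ℤ)⟧').f p =
    (lift0 φ g h).f p ≫ (mappingCone.map g g' b c hbc).f (p + -1) := rfl
  rw [e, HomologicalComplex.comp_f, lift0_f, lift0_f]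
  have e2 : a.f p ≫ φ'.f p = φ.f p ≫ b.f p := by
    rw [← HomologicalComplex.comp_f, ← hab, HomologicalComplex.comp_f]
  have e3 : (mappingCone.inl g).v p (p + -1) (by lia) ≫ (mappingCone.map g g' b c hbc).f (p + -1)
     = b.f p ≫ (mappingCone.inl g').v p (p + -1) (by lia) := by
    simp [mappingCone.map]
  refine (Category.assoc _ _ _).symm.trans ?_
  refine Eq.trans ?_ (Category.assoc _ _ _).symm
  refine (congrArg (fun z => z ≫ (mappingCone.inl g').v p (p + -1) (by lia)) e2).trans ?_
  refine (Category.assoc _ _ _).trans ?_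
  exact (congrArg (fun z => φ.f p ≫ z) e3).symm

variable (J₀ J₁ : 𝒜 ⥤ 𝒜) [J₁.Additive] [J₀.Additive] (η : 𝟭 𝒜 ⟶ J₀) (π : J₀ ⟶ J₁)
  (hηπ : ∀ M, η.app M ≫ π.app M = 0)

/-- natural transformation from complexes -/
noncomputable def etaC : 𝟭 Cx ⟶ C(J₀) :=
  { app := fun K => { f := fun _ => η.app _, comm' := fun i j _ => (η.naturality (K.d i j)).symm },
    naturality := fun K L f => by ext n; exact η.naturality (f.f n) }

/-- natural right resolutions -/
structure CoresData where
  Z : Cx ⥤ Cx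
  θ : 𝟭 Cx ⟶ Z
  qis : ∀ K, QuasiIso (θ.app K)

noncomputable def CoresData.nextα (D : CoresData (𝒜 := 𝒜)) : C(J₀) ⟶ C(J₁) ⋙ D.Z :=
  { app K := (NatTrans.mapHomologicalComplex π (ComplexShape.up ℤ)).app K ≫ D.θ.app (C(J₁).obj K)
    naturality K L f := by
      have h1 := D.θ.naturality (C(J₁).map f)
      have h2 := (NatTrans.mapHomologicalComplex π (ComplexShape.up ℤ)).naturality f
      simp only [Functor.id_map, Functor.id_obj] at h1
      simp only [Functor.comp_map, Category.assoc]
      rw [← h1, reassoc_of% h2] }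

lemma etaC_piC (hηπ : ∀ M, η.app M ≫ π.app M = 0) (K : Cx) :
    (etaC J₀ η).app K ≫ (NatTrans.mapHomologicalComplex π (ComplexShape.up ℤ)).app K = 0 := by
  ext n
  exact hηπ _

lemma shortExactC' (hse : ∀ M, (ShortComplex.mk _ _ (hηπ M)).ShortExact) (K : Cx) :
    (ShortComplex.mk _ _ (etaC_piC J₀ J₁ η π hηπ K)).ShortExact :=
  HomologicalComplex.shortExact_of_degreewise_shortExact _ fun i => hse (K.X i)

lemma CoresData.comp_nextα (D : CoresData (𝒜 := 𝒜)) (hηπ : ∀ M, η.app M ≫ π.app M = 0) (K : Cx) :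
    (etaC J₀ η).app K ≫ (D.nextα J₀ J₁ π).app K = 0 := by
  have := etaC_piC J₀ J₁ η π hηπ K
  simp only [nextα]
  rw [← Category.assoc, this, zero_comp]

/-- the next step of the resolution -/
noncomputable def CoresData.next (D : CoresData (𝒜 := 𝒜))
    (hse : ∀ M, (ShortComplex.mk _ _ (hηπ M)).ShortExact) : CoresData (𝒜 := 𝒜) where
  Z := coneFunctor (D.nextα J₀ J₁ π) ⋙ CategoryTheory.shiftFunctor Cx (-1 : ℤ)
  θ :=
    { app K := lift0 ((etaC J₀ η).app K) _ (D.comp_nextα J₀ J₁ η π hηπ K)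
      naturality K L f := by
        exact lift0_naturality _ _ _ _ _ _ f _ _ ((etaC J₀ η).naturality f).symm
          ((D.nextα J₀ J₁ π).naturality f).symm }
  qis K := by
    have h1 := D.qis (C(J₁).obj K)
    have h3 := quasiIso_desc0 _ _ _ (shortExactC' J₀ J₁ η π hηπ hse K)
    have h4 := desc0_comp ((etaC J₀ η).app K)
      ((NatTrans.mapHomologicalComplex π (ComplexShape.up ℤ)).app K)
      (etaC_piC J₀ J₁ η π hηπ K) (D.θ.app (C(J₁).obj K)) ((D.nextα J₀ J₁ π).app K) rfl
    have h5 : QuasiIso (_ ≫ _) := quasiIso_comp (hφ := h3) (hφ' := h1)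
    rw [h4] at h5
    exact quasiIso_lift0 _ _ _

/-- the iterated resolution -/
noncomputable def coresIter (hse : ∀ M, (ShortComplex.mk _ _ (hηπ M)).ShortExact) :
    ℕ → CoresData (𝒜 := 𝒜)
  | 0 => ⟨𝟭 _, 𝟙 _, fun K => by dsimp; infer_instance⟩
  | (m + 1) => (coresIter hse m).next J₀ J₁ η π hηπ hse

lemma coresIter_mem (hse : ∀ M, (ShortComplex.mk _ _ (hηπ M)).ShortExact)
    (E : ObjectProperty 𝒜) [E.IsClosedUnderIsomorphisms]
    (hE : ∀ X Y, E X → E Y → E (X ⊞ Y)) (hP : ∀ M, E (J₀.obj M)) (m : ℕ) :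
    ∀ (K : Cx) (_ : ∀ n, syzIter J₁ E m (K.X n)) (n : ℤ),
      E (((coresIter J₀ J₁ η π hηπ hse m).Z.obj K).X n) := by
  induction m with
  | zero => intro K hK n; exact hK n
  | succ m ih =>
    intro K hK n
    exact cone_X_mem E hE ((CoresData.nextα J₀ J₁ π (coresIter J₀ J₁ η π hηπ hse m)).app K) (fun _ => hP _) (ih (C(J₁).obj K) hK) (n + -1)
end
end

section
open CategoryTheory Limits

section
universe v₁ u₁ v₂ u₂
variable {𝒜 : Type u₁} [Category.{v₁} 𝒜] [Abelian 𝒜] [HasDerivedCategory 𝒜]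
variable {ℬ : Type u₂} [Category.{v₂} ℬ] [Abelian ℬ] [HasDerivedCategory ℬ]

lemma hasBinaryBiproducts_fullSub (E : ObjectProperty 𝒜) (hE : ∀ X Y, E X → E Y → E (X ⊞ Y)) :
    HasBinaryBiproducts E.FullSubcategory where
  has_binary_biproduct X Y := by
    let b : BinaryBicone X Y :=
      { pt := ⟨X.obj ⊞ Y.obj, hE _ _ X.property Y.property⟩
        fst := E.homMk biprod.fst
        snd := E.homMk biprod.snd
        inl := E.homMk biprod.inl
        inr := E.homMk biprod.inr
        inl_fst := by ext; exact biprod.inl_fst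
        inl_snd := by ext; exact biprod.inl_snd
        inr_fst := by ext; exact biprod.inr_fst
        inr_snd := by ext; exact biprod.inr_snd }
    refine HasBinaryBiproduct.mk ⟨b, isBinaryBilimitOfTotal b ?_⟩
    apply ObjectProperty.hom_ext
    exact biprod.total (X := X.obj) (Y := Y.obj)

lemma packaged (E : ObjectProperty 𝒜) (Y : ObjectProperty ℬ)
    [E.ContainsZero] [E.IsClosedUnderIsomorphisms] [Y.IsClosedUnderIsomorphisms]
    (hE : ∀ X X', E X → E X' → E (X ⊞ X')) (hY : ∀ X X', Y X → Y X' → Y (X ⊞ X'))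
    (F : 𝒜 ⥤ ℬ) (G : ℬ ⥤ 𝒜) [F.Additive] [G.Additive]
    (hF : ∀ M, E M → Y (F.obj M)) (hG : ∀ N, Y N → E (G.obj N))
    (η : 𝟭 𝒜 ⟶ F ⋙ G) (ε : G ⋙ F ⟶ 𝟭 ℬ)
    (hη : ∀ M, E M → IsIso (η.app M)) (hε : ∀ N, Y N → IsIso (ε.app N))
    (P₁ P₀ : 𝒜 ⥤ 𝒜) [P₁.Additive] [P₀.Additive] (ι : P₁ ⟶ P₀) (e : P₀ ⟶ 𝟭 𝒜)
    (hιe : ∀ M, ι.app M ≫ e.app M = 0) (hse : ∀ M, (ShortComplex.mk _ _ (hιe M)).ShortExact)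
    (hP : ∀ M, E (P₀.obj M)) (m : ℕ) (hm : ∀ M, syzIter P₁ E m M)
    (J₀ J₁ : ℬ ⥤ ℬ) [J₁.Additive] [J₀.Additive] (h : 𝟭 ℬ ⟶ J₀) (π : J₀ ⟶ J₁)
    (hhπ : ∀ M, h.app M ≫ π.app M = 0) (hse' : ∀ M, (ShortComplex.mk _ _ (hhπ M)).ShortExact)
    (hJ : ∀ M, Y (J₀.obj M)) (m' : ℕ) (hm' : ∀ M, syzIter J₁ Y m' M)
    (hac : ∀ K : CochainComplex 𝒜 ℤ, (∀ i, E (K.X i)) →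
      (K.Acyclic ↔ ((F.mapHomologicalComplex (ComplexShape.up ℤ)).obj K).Acyclic)) :
    ∃ (F : DerivedCategory 𝒜 ⥤ DerivedCategory ℬ) (c : F.CommShift ℤ),
      haveI := c; F.IsTriangulated ∧ F.IsEquivalence := by
  have := hasBinaryBiproducts_fullSub E hE
  let eqv : E.FullSubcategory ≌ Y.FullSubcategory :=
    CategoryTheory.Equivalence.mk
      (Y.lift (E.ι ⋙ F) (fun X => hF _ X.property))
      (E.lift (Y.ι ⋙ G) (fun X => hG _ X.property))
      (NatIso.ofComponents (fun X => E.isoMk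
          (@asIso _ _ _ _ (η.app X.obj) (hη _ X.property)))
        (fun f => by ext; exact η.naturality f.hom))
      (NatIso.ofComponents (fun X => Y.isoMk
          (@asIso _ _ _ _ (ε.app X.obj) (hε _ X.property)))
        (fun f => by ext; exact ε.naturality f.hom))
  let q : E.FullSubcategory ⥤ ℬ := eqv.functor ⋙ Y.ι
  have hqF : q = E.ι ⋙ F := rfl
  have : q.Full := inferInstance
  have : q.Faithful := inferInstance
  have : q.Additive := by rw [hqF]; infer_instance
  let R := resIter P₁ P₀ ι e hιe hse m
  have hR : ∀ K n, E ((R.Z.obj K).X n) := fun K n =>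
    resIter_mem P₁ P₀ ι e hιe hse E hE hP m K (fun n => hm _) n
  let R' := coresIter J₀ J₁ h π hhπ hse' m'
  have hR' : ∀ K n, Y ((R'.Z.obj K).X n) := fun K n =>
    coresIter_mem J₀ J₁ h π hhπ hse' Y hY hJ m' K (fun n => hm' _) n
  let σ : CochainComplex ℬ ℤ ⥤ CochainComplex E.FullSubcategory ℤ :=
    HomologicalComplex.liftFunctorObjectProperty E
      (R'.Z ⋙ G.mapHomologicalComplex (ComplexShape.up ℤ)) (fun K n => hG _ (hR' K n))
  let jj : σ ⋙ q.mapHomologicalComplex (ComplexShape.up ℤ) ⟶ R'.Z :=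
    { app K := { f n := ε.app ((R'.Z.obj K).X n)
                 comm' := fun i j _ => (ε.naturality ((R'.Z.obj K).d i j)).symm }
      naturality := fun K L f => by
        ext n
        exact ε.naturality ((R'.Z.map f).f n) }
  have : ∀ K, IsIso (jj.app K) := fun K => by
    have : ∀ n, IsIso ((jj.app K).f n) := fun n => hε _ (hR' K n)
    exact HomologicalComplex.Hom.isIso_of_components _
  have : IsIso jj := NatIso.isIso_of_isIso_app _
  refine abstract_equiv E.ι q
    (HomologicalComplex.liftFunctorObjectProperty E R.Z hR)
    { app := fun K => R.θ.app K, naturality := fun K L f => R.θ.naturality f }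
    (fun K => R.qis K) σ (R'.θ ≫ inv jj) (fun K => ?_) (fun K => ?_)
  · have := R'.qis K
    rw [NatTrans.comp_app]
    infer_instance
  · exact hac _ (fun i => (K.X i).property)

variable (𝒜 ℬ) in
def TriEq : Prop := ∃ (F : DerivedCategory 𝒜 ⥤ DerivedCategory ℬ) (c : F.CommShift ℤ),
      haveI := c; F.IsTriangulated ∧ F.IsEquivalence

lemma TriEq.trans {𝒞 : Type*} [Category 𝒞] [Abelian 𝒞] [HasDerivedCategory 𝒞]
    (h : TriEq 𝒜 ℬ) (h' : TriEq ℬ 𝒞) : TriEq 𝒜 𝒞 := by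
  obtain ⟨F, c, h1, h2⟩ := h
  obtain ⟨F', c', h1', h2'⟩ := h'
  exact ⟨F ⋙ F', inferInstance, inferInstance, inferInstance⟩

lemma TriEq.ofEquiv (e : 𝒜 ≌ ℬ) : TriEq 𝒜 ℬ := by
  have : e.functor.Additive := Functor.additive_of_preserves_binary_products _
  let C := e.functor.mapHomologicalComplex (ComplexShape.up ℤ)
  let D := e.inverse.mapHomologicalComplex (ComplexShape.up ℤ)
  let j : 𝟭 _ ⟶ D ⋙ C :=
    { app K := { f n := e.counitInv.app (K.X n)
                 comm' := fun i j _ => (e.counitInv.naturality (K.d i j)).symm }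
      naturality := fun K L f => by
        ext n
        exact e.counitInv.naturality (f.f n) }
  have hj : ∀ K, IsIso (j.app K) := fun K => by
    have : ∀ n, IsIso ((j.app K).f n) := fun n =>
      inferInstanceAs (IsIso (e.counitInv.app (K.X n)))
    exact HomologicalComplex.Hom.isIso_of_components _
  let i : (𝟭 _) ⋙ (𝟭 𝒜).mapHomologicalComplex (ComplexShape.up ℤ) ⟶ 𝟭 (CochainComplex 𝒜 ℤ) :=
    { app K := { f n := 𝟙 (K.X n)
                 comm' := fun i j _ => (Category.id_comp _).trans (Category.comp_id (K.d i j)).symm }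
      naturality := fun K L f => by
        ext n; exact (Category.comp_id _).trans (Category.id_comp _).symm }
  have hi : ∀ K, IsIso (i.app K) := fun K => by
    have : ∀ n, IsIso ((i.app K).f n) := fun n => inferInstanceAs (IsIso (𝟙 _))
    exact HomologicalComplex.Hom.isIso_of_components _
  refine abstract_equiv (𝟭 𝒜) e.functor (𝟭 _) i (fun K => ?_) D j (fun K => ?_) (fun K => ?_)
  · have := hi K
    infer_instance
  · infer_instance
  · have := e.functor.preservesZeroMorphisms_of_additive
    refine forall_congr' (fun i => ?_)
    change (HomologicalComplex.sc K i).Exact ↔ ((HomologicalComplex.sc K i).map e.functor).Exact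
    exact (ShortComplex.exact_map_iff_of_faithful _ e.functor).symm
end
end

section
open CategoryTheory Limits
open scoped ZeroObject

section
variable (k : Type) [Field k] (β : ℤ → ℤ)

/-- Representations of the linear quiver bounded by `β`. -/
def RepP : ObjectProperty (ℤ ⥤ ModuleCat.{0} k) :=
  fun M => ∀ (x y : ℤ) (h : x ≤ y), β x < y → M.map (homOfLE h) = 0

instance : (RepP k β).IsClosedUnderSubobjects where
  prop_of_mono {X Y} f _ hY := fun x y h hxy => by
    rw [← cancel_mono (f.app y), f.naturality, hY x y h hxy]; simp

instance : (RepP k β).IsClosedUnderQuotients where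
  prop_of_epi {X Y} f _ hX := fun x y h hxy => by
    rw [← cancel_epi (f.app x), ← f.naturality, hX x y h hxy]; simp

instance : (RepP k β).ContainsZero where
  exists_zero := ⟨0, isZero_zero _, fun x y _ _ =>
    IsZero.eq_of_src ((isZero_zero (ℤ ⥤ ModuleCat.{0} k)).obj x) _ _⟩

instance : (RepP k β).IsClosedUnderFiniteProducts where
  isClosedUnderLimitsOfShape J _ := ⟨by
    rintro X ⟨p⟩ x y h hxy
    have hl := isLimitOfPreserves ((evaluation ℤ (ModuleCat.{0} k)).obj y) p.isLimit
    refine hl.hom_ext (fun j => ?_)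
    have e : X.map (homOfLE h) ≫ (p.π.app j).app y = (p.π.app j).app x ≫ (p.diag.obj j).map (homOfLE h) :=
      (p.π.app j).naturality (homOfLE h)
    have e2 : (p.diag.obj j).map (homOfLE h) = 0 := p.prop_diag_obj j x y h hxy
    rw [e2, comp_zero] at e
    exact e.trans zero_comp.symm⟩

abbrev Rep' := (RepP k β).FullSubcategory

noncomputable instance : Abelian (Rep' k β) := inferInstance

/-- evaluation functor -/
noncomputable abbrev evF (x : ℤ) : Rep' k β ⥤ ModuleCat.{0} k := (RepP k β).ι ⋙ (evaluation ℤ (ModuleCat.{0} k)).obj x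

instance (x : ℤ) : (evF k β x).Additive := ⟨rfl⟩

instance : PreservesFiniteLimits (RepP k β).ι := by
  have := (RepP k β).preservesKernels_ι
  exact Functor.preservesFiniteLimits_of_preservesKernels _

instance : PreservesFiniteColimits (RepP k β).ι := by
  have := (RepP k β).preservesCokernels_ι
  exact Functor.preservesFiniteColimits_of_preservesCokernels _

instance (x : ℤ) : PreservesFiniteLimits (evF k β x) := comp_preservesFiniteLimits _ _
instance (x : ℤ) : PreservesFiniteColimits (evF k β x) := comp_preservesFiniteColimits _ _

variable {k β}

lemma evF_isZero_iff (X : Rep' k β) : IsZero X ↔ ∀ x, IsZero ((evF k β x).obj X) := by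
  refine ⟨fun h x => (evF k β x).map_isZero h, fun h => ?_⟩
  refine IsZero.of_full_of_faithful_of_isZero (RepP k β).ι X ?_
  exact Functor.isZero _ (fun x => h x)

lemma exact_iff_evF (S : ShortComplex (Rep' k β)) :
    S.Exact ↔ ∀ x, (S.map (evF k β x)).Exact := by
  refine ⟨fun h x => h.map _, fun h => ?_⟩
  rw [ShortComplex.exact_iff_isZero_homology, evF_isZero_iff]
  intro x
  have := (ShortComplex.exact_iff_isZero_homology _).1 (h x)
  exact this.of_iso (S.mapHomologyIso (evF k β x)).symm

/-- the restriction maps -/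
noncomputable def res (M : ℤ ⥤ ModuleCat.{0} k) {x y : ℤ} (h : x ≤ y) : M.obj x →ₗ[k] M.obj y :=
  (M.map (homOfLE h)).hom

noncomputable def ev {M N : Rep' k β} (f : M ⟶ N) (x : ℤ) : M.obj.obj x →ₗ[k] N.obj.obj x :=
  (f.hom.app x).hom

lemma res_self (M : ℤ ⥤ ModuleCat.{0} k) {x : ℤ} (h : x ≤ x) (m : M.obj x) : res M h m = m := by
  exact congrArg (fun z => z.hom m) (M.map_id x)

lemma res_res (M : ℤ ⥤ ModuleCat.{0} k) {x y z : ℤ} (h : x ≤ y) (h' : y ≤ z) (m : M.obj x) :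
    res M h' (res M h m) = res M (h.trans h') m := by
  have : M.map (homOfLE (h.trans h')) = M.map (homOfLE h) ≫ M.map (homOfLE h') :=
    M.map_comp (homOfLE h) (homOfLE h')
  exact (congrArg (fun z => z.hom m) this).symm

lemma res_ev {M N : Rep' k β} (f : M ⟶ N) {x y : ℤ} (h : x ≤ y) (m : M.obj.obj x) :
    ev f y (res M.obj h m) = res N.obj h (ev f x m) := by
  exact congrArg (fun z => z.hom m) (f.hom.naturality (homOfLE h))

lemma res_zero (M : Rep' k β) {x y : ℤ} (h : x ≤ y) (hxy : β x < y) (m : M.obj.obj x) :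
    res M.obj h m = 0 := by
  have := M.property x y h hxy
  simp [res, this]

lemma ev_comp {M N L : Rep' k β} (f : M ⟶ N) (g : N ⟶ L) (x : ℤ) (m : M.obj.obj x) :
    ev (f ≫ g) x m = ev g x (ev f x m) := rfl

lemma ev_id (M : Rep' k β) (x : ℤ) (m : M.obj.obj x) :
    ev (𝟙 M) x m = m := rfl

lemma ev_add {M N : Rep' k β} (f g : M ⟶ N) (x : ℤ) (m : M.obj.obj x) :
    ev (f + g) x m = ev f x m + ev g x m := rfl

lemma ev_zero {M N : Rep' k β} (x : ℤ) (m : M.obj.obj x) :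
    ev (0 : M ⟶ N) x m = 0 := rfl

lemma ev_ext {M N : Rep' k β} (f g : M ⟶ N) (h : ∀ x m, ev f x m = ev g x m) : f = g := by
  apply ObjectProperty.hom_ext
  ext x m
  exact h x m

/-- builder -/
noncomputable def mkF (V : ℤ → Type) [∀ x, AddCommGroup (V x)] [∀ x, Module k (V x)]
    (r : ∀ x y, x ≤ y → (V x →ₗ[k] V y)) (hid : ∀ x h v, r x x h v = v)
    (hc : ∀ x y z h h' v, r y z h' (r x y h v) = r x z (h.trans h') v) : ℤ ⥤ ModuleCat.{0} k where
  obj x := ModuleCat.of k (V x)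
  map {x y} f := ModuleCat.ofHom (r x y (leOfHom f))
  map_id x := by ext v; exact hid x _ v
  map_comp {x y z} f g := by ext v; exact (hc x y z _ _ v).symm

noncomputable def mkR (V : ℤ → Type) [∀ x, AddCommGroup (V x)] [∀ x, Module k (V x)]
    (r : ∀ x y, x ≤ y → (V x →ₗ[k] V y)) (hid : ∀ x h v, r x x h v = v)
    (hc : ∀ x y z h h' v, r y z h' (r x y h v) = r x z (h.trans h') v)
    (h0 : ∀ x y h v, β x < y → r x y h v = 0) : Rep' k β :=
  ⟨mkF V r hid hc, fun x y h hxy => by ext v; exact h0 x y h v hxy⟩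

noncomputable def mkH {M N : Rep' k β} (f : ∀ x, M.obj.obj x →ₗ[k] N.obj.obj x)
    (hf : ∀ x y (h : x ≤ y) m, f y (res M.obj h m) = res N.obj h (f x m)) : M ⟶ N :=
  (RepP k β).homMk
  { app x := ModuleCat.ofHom (f x)
    naturality x y g := by ext m; exact hf x y (leOfHom g) m }

lemma ev_mkH {M N : Rep' k β} (f : ∀ x, M.obj.obj x →ₗ[k] N.obj.obj x) (hf) (x : ℤ) (m) :
    ev (mkH (M := M) (N := N) f hf) x m = f x m := rfl

lemma isIso_of_ev {M N : Rep' k β} (f : M ⟶ N) (h : ∀ x, Function.Bijective (ev f x)) : IsIso f := by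
  have : ∀ x, IsIso (f.hom.app x) := fun x => by
    rw [ConcreteCategory.isIso_iff_bijective]
    exact h x
  have : IsIso f.hom := NatIso.isIso_of_isIso_app _
  exact (isIso_iff_of_reflects_iso f (RepP k β).ι).1 this

lemma ev_inj_of_mono {M N : Rep' k β} (f : M ⟶ N) [Mono f] (x : ℤ) : Function.Injective (ev f x) := by
  have : Mono ((evF k β x).map f) := inferInstance
  exact (ModuleCat.mono_iff_injective _).1 this

lemma ev_surj_of_epi {M N : Rep' k β} (f : M ⟶ N) [Epi f] (x : ℤ) : Function.Surjective (ev f x) := by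
  have : Epi ((evF k β x).map f) := inferInstance
  exact (ModuleCat.epi_iff_surjective _).1 this

lemma mono_of_ev {M N : Rep' k β} (f : M ⟶ N) (h : ∀ x, Function.Injective (ev f x)) : Mono f :=
  ⟨fun g g' e => ev_ext _ _ fun x m => h x (by rw [← ev_comp, e, ev_comp])⟩

lemma epi_of_ev {M N : Rep' k β} (f : M ⟶ N) (h : ∀ x, Function.Surjective (ev f x)) : Epi f :=
  ⟨fun g g' e => ev_ext _ _ fun x m => by
    obtain ⟨m, rfl⟩ := h x m
    rw [← ev_comp, e, ev_comp]⟩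

lemma acyclic_iff_ev (K : CochainComplex (Rep' k β) ℤ) : K.Acyclic ↔
    ∀ (i : ℤ) (x : ℤ) (m : (K.X i).obj.obj x), ev (K.d i (i+1)) x m = 0 →
      ∃ m' : (K.X (i-1)).obj.obj x, ev (K.d (i-1) i) x m' = m := by
  refine forall_congr' (fun i => ?_)
  rw [K.exactAt_iff' (i-1) i (i+1) (by simp) (by simp), exact_iff_evF]
  refine forall_congr' (fun x => ?_)
  rw [ShortComplex.moduleCat_exact_iff]
  rfl
end
end

section
open CategoryTheory Limits

section
universe v u
variable {𝒜 : Type u} [Category.{v} 𝒜] [Abelian 𝒜]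

noncomputable def kerFun {P₀ : 𝒜 ⥤ 𝒜} (e : P₀ ⟶ 𝟭 𝒜) : 𝒜 ⥤ 𝒜 where
  obj M := kernel (e.app M)
  map {M N} f := kernel.map (e.app M) (e.app N) (P₀.map f) f (e.naturality f).symm
  map_id M := by ext; simp
  map_comp f g := by ext; simp

noncomputable def kerFunι {P₀ : 𝒜 ⥤ 𝒜} (e : P₀ ⟶ 𝟭 𝒜) : kerFun e ⟶ P₀ where
  app M := kernel.ι (e.app M)
  naturality {M N} f := by simp [kerFun]

instance {P₀ : 𝒜 ⥤ 𝒜} (e : P₀ ⟶ 𝟭 𝒜) (M : 𝒜) : Mono ((kerFunι e).app M) :=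
  inferInstanceAs (Mono (kernel.ι (e.app M)))

instance {P₀ : 𝒜 ⥤ 𝒜} [P₀.Additive] (e : P₀ ⟶ 𝟭 𝒜) : (kerFun e).Additive where
  map_add {M N f g} := by
    rw [← cancel_mono ((kerFunι e).app N)]
    have h := fun (f : M ⟶ N) => (kerFunι e).naturality f
    rw [Preadditive.add_comp, h, h, h, Functor.map_add, Preadditive.comp_add]

lemma kerFunι_comp {P₀ : 𝒜 ⥤ 𝒜} (e : P₀ ⟶ 𝟭 𝒜) (M : 𝒜) : (kerFunι e).app M ≫ e.app M = 0 :=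
  kernel.condition _

lemma kerFun_shortExact {P₀ : 𝒜 ⥤ 𝒜} (e : P₀ ⟶ 𝟭 𝒜) (he : ∀ M, Epi (e.app M)) (M : 𝒜) :
    (ShortComplex.mk _ _ (kerFunι_comp e M)).ShortExact := by
  have := he M
  refine @ShortComplex.ShortExact.mk _ _ _ _ ?_ (inferInstanceAs (Mono (kernel.ι (e.app M)))) this
  exact ShortComplex.exact_of_f_is_kernel _ (kernelIsKernel (e.app M))

noncomputable def cokFun {J₀ : 𝒜 ⥤ 𝒜} (e : 𝟭 𝒜 ⟶ J₀) : 𝒜 ⥤ 𝒜 where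
  obj M := cokernel (e.app M)
  map {M N} f := cokernel.map (e.app M) (e.app N) f (J₀.map f) (e.naturality f).symm
  map_id M := by ext; simp
  map_comp f g := by ext; simp

noncomputable def cokFunπ {J₀ : 𝒜 ⥤ 𝒜} (e : 𝟭 𝒜 ⟶ J₀) : J₀ ⟶ cokFun e where
  app M := cokernel.π (e.app M)
  naturality {M N} f := by simp [cokFun]

instance {J₀ : 𝒜 ⥤ 𝒜} (e : 𝟭 𝒜 ⟶ J₀) (M : 𝒜) : Epi ((cokFunπ e).app M) :=
  inferInstanceAs (Epi (cokernel.π (e.app M)))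

instance {J₀ : 𝒜 ⥤ 𝒜} [J₀.Additive] (e : 𝟭 𝒜 ⟶ J₀) : (cokFun e).Additive where
  map_add {M N f g} := by
    rw [← cancel_epi ((cokFunπ e).app M)]
    have h := fun (f : M ⟶ N) => (cokFunπ e).naturality f
    rw [Preadditive.comp_add, ← h, ← h, ← h, Functor.map_add, Preadditive.add_comp]

lemma cokFunπ_comp {J₀ : 𝒜 ⥤ 𝒜} (e : 𝟭 𝒜 ⟶ J₀) (M : 𝒜) : e.app M ≫ (cokFunπ e).app M = 0 :=
  cokernel.condition _

lemma cokFun_shortExact {J₀ : 𝒜 ⥤ 𝒜} (e : 𝟭 𝒜 ⟶ J₀) (he : ∀ M, Mono (e.app M)) (M : 𝒜) :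
    (ShortComplex.mk _ _ (cokFunπ_comp e M)).ShortExact := by
  have := he M
  refine @ShortComplex.ShortExact.mk _ _ _ _ ?_ this (inferInstanceAs (Epi (cokernel.π (e.app M))))
  exact ShortComplex.exact_of_g_is_cokernel _ (cokernelIsCokernel (e.app M))
end

section
variable {k : Type} [Field k] {β : ℤ → ℤ}

/-- the free cover at `x` -/
def p0S (M : Rep' k β) (x : ℤ) : Submodule k (∀ x' : ℤ, M.obj.obj x') where
  carrier := {p | ∀ x', ¬ (x' ≤ x ∧ x ≤ β x') → p x' = 0}
  add_mem' {p q} hp hq := fun x' h => by simp [hp x' h, hq x' h]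
  zero_mem' := fun x' h => rfl
  smul_mem' c p hp := fun x' h => by simp [hp x' h]

def p0r (M : Rep' k β) (x y : ℤ) (h : x ≤ y) : p0S M x →ₗ[k] p0S M y where
  toFun p := ⟨fun x' => if y ≤ β x' then p.1 x' else 0, fun x' h' => by
    dsimp only
    split_ifs with h1
    · exact p.2 x' (by grind)
    · rfl⟩
  map_add' p q := by ext x'; simp only [Submodule.coe_add, Pi.add_apply]; split_ifs <;> simp
  map_smul' c q := by ext x'; simp only [Submodule.coe_smul, Pi.smul_apply, RingHom.id_apply]; split_ifs <;> simp

lemma p0r_apply (M : Rep' k β) (x y : ℤ) (h : x ≤ y) (p : p0S M x) (x' : ℤ) :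
  (p0r M x y h p).1 x' = if y ≤ β x' then p.1 x' else 0 := rfl

noncomputable def P0obj (M : Rep' k β) (hβ : Monotone β) : Rep' k β :=
  mkR (fun x => p0S M x) (p0r M)
    (fun x h p => by
      ext x'; rw [p0r_apply]; split_ifs with h1
      · rfl
      · exact (p.2 x' (by grind)).symm)
    (fun x y z h h' p => by
      ext x'; rw [p0r_apply, p0r_apply, p0r_apply]; split_ifs <;> first | rfl | grind)
    (fun x y h p hxy => by
      ext x'; rw [p0r_apply]; split_ifs with h1
      · refine p.2 x' ?_
        rintro ⟨h2, h3⟩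
        have := hβ h2
        omega
      · rfl)

noncomputable def P0 (hβ : Monotone β) : Rep' k β ⥤ Rep' k β where
  obj M := P0obj M hβ
  map {M N} f := mkH (M := P0obj M hβ) (N := P0obj N hβ) (fun x =>
      ({ toFun p := ⟨fun x' => ev f x' (p.1 x'), fun x' h => by
           dsimp only; rw [p.2 x' h, map_zero]⟩
         map_add' p q := by ext x'; exact map_add (ev f x') _ _
         map_smul' c p := by ext x'; exact map_smul (ev f x') _ _ } : p0S M x →ₗ[k] p0S N x))
    (fun x y h (m : p0S M x) => by
      apply Subtype.ext
      funext x'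
      change ev f x' (if y ≤ β x' then m.1 x' else 0) = if y ≤ β x' then ev f x' (m.1 x') else 0
      split_ifs
      · rfl
      · exact map_zero _)
  map_id M := ev_ext _ _ fun x m => rfl
  map_comp f g := ev_ext _ _ fun x m => rfl

instance (hβ : Monotone β) : (P0 (k := k) hβ).Additive where
  map_add := ev_ext _ _ fun x m => rfl

/-- the augmentation -/
noncomputable def p0e (M : Rep' k β) (x : ℤ) : p0S M x →ₗ[k] M.obj.obj x where
  toFun p := ∑ x' ∈ (Finset.Icc 1 x).attach, res M.obj (Finset.mem_Icc.1 x'.2).2 (p.1 x')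
  map_add' p q := by simp [Finset.sum_add_distrib]
  map_smul' c p := by simp [Finset.smul_sum]

lemma p0e_apply (M : Rep' k β) (x : ℤ) (p : p0S M x) :
    p0e M x p = ∑ x' ∈ Finset.Icc 1 x, if h : x' ≤ x then res M.obj h (p.1 x') else 0 := by
  refine Eq.trans ?_ (Finset.sum_attach (Finset.Icc 1 x)
    (fun x' => if h : x' ≤ x then res M.obj h (p.1 x') else 0))
  have h : ∀ x' : ↥(Finset.Icc 1 x), (if h : x'.1 ≤ x then res M.obj h (p.1 x') else 0) =
      res M.obj (Finset.mem_Icc.1 x'.2).2 (p.1 x') := fun x' => dif_pos _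
  simp only [h]
  rfl

noncomputable def P0e (hβ : Monotone β) : P0 (k := k) hβ ⟶ 𝟭 (Rep' k β) where
  app M := mkH (M := P0obj M hβ) (N := M) (fun x => p0e M x) (fun x y h (m : p0S M x) => by
    change p0e M y (p0r M x y h m) = res M.obj h (p0e M x m)
    rw [p0e_apply, p0e_apply, map_sum]
    have hs : Finset.Icc 1 x ⊆ Finset.Icc 1 y := Finset.Icc_subset_Icc_right h
    rw [← Finset.sum_subset hs]
    · refine Finset.sum_congr rfl (fun x' hx' => ?_)
      have hx := (Finset.mem_Icc.1 hx').2
      rw [dif_pos hx, dif_pos (hx.trans h), p0r_apply, res_res]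
      split_ifs with h1
      · rfl
      · rw [map_zero, res_zero]; omega
    · intro x' hx' hx''
      have : ¬ (x' ≤ x) := fun h' => hx'' (Finset.mem_Icc.2 ⟨(Finset.mem_Icc.1 hx').1, h'⟩)
      rw [dif_pos (Finset.mem_Icc.1 hx').2, p0r_apply, m.2 x' (by tauto)]
      simp)
  naturality M N f := ev_ext _ _ fun x (m : p0S M x) => by
    refine (p0e_apply N x _).trans ?_
    change _ = ev f x (p0e M x m)
    rw [p0e_apply, map_sum]
    refine Finset.sum_congr rfl (fun x' hx' => ?_)
    have hx := (Finset.mem_Icc.1 hx').2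
    rw [dif_pos hx, dif_pos hx, res_ev]
    rfl

lemma rep_zero (M : Rep' k β) {x : ℤ} (h : β x < x) (m : M.obj.obj x) : m = 0 := by
  rw [← res_self M.obj le_rfl m, res_zero M le_rfl h]

lemma P0e_epi (hβ : Monotone β) (hlow : ∀ x < 1, β x < x) (M : Rep' k β) :
    Epi ((P0e (k := k) hβ).app M) := by
  refine epi_of_ev _ (fun x m => ?_)
  by_cases hx : 1 ≤ x ∧ x ≤ β x
  · classical
    refine ⟨(⟨Pi.single x m, fun x' h => ?_⟩ : p0S M x), ?_⟩
    · exact Pi.single_eq_of_ne (by grind) _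
    · refine (p0e_apply M x _).trans ?_
      rw [Finset.sum_eq_single x]
      · rw [dif_pos le_rfl, res_self]; exact Pi.single_eq_same _ _
      · intro b _ hb
        split_ifs
        · refine (congrArg (res M.obj _) (Pi.single_eq_of_ne hb _)).trans (map_zero _)
        · rfl
      · intro h; exact absurd (Finset.mem_Icc.2 ⟨hx.1, le_rfl⟩) h
  · refine ⟨0, ?_⟩
    rw [rep_zero M _ m, map_zero]
    by_contra h
    exact hx ⟨by by_contra h'; exact h (hlow x (by omega)), by omega⟩

lemma P0_ker_zero (hβ : Monotone β) (hlow : ∀ x < 1, β x < x) (M : Rep' k β) (c : ℤ)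
    (hM : ∀ x < c, ∀ m : M.obj.obj x, m = 0) (x : ℤ) (hx : x ≤ c)
    (m : ((kerFun (P0e (k := k) hβ)).obj M).obj.obj x) : m = 0 := by
  apply ev_inj_of_mono ((kerFunι (P0e (k := k) hβ)).app M) x
  rw [map_zero]
  have h0 : ev ((P0e (k := k) hβ).app M) x (ev ((kerFunι (P0e (k := k) hβ)).app M) x m) = 0 := by
    rw [← ev_comp, kerFunι_comp]; rfl
  generalize ev ((kerFunι (P0e (k := k) hβ)).app M) x m = p at h0
  change p0S M x at p
  change p0e M x p = 0 at h0
  rw [p0e_apply] at h0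
  apply Subtype.ext
  funext x'
  change p.1 x' = 0
  rcases lt_trichotomy x' x with h | h | h
  · exact hM x' (by omega) _
  · subst h
    by_cases h1 : x' < 1
    · exact rep_zero M (hlow _ h1) _
    rw [Finset.sum_eq_single x'] at h0
    · rw [dif_pos le_rfl, res_self] at h0; exact h0
    · intro b hb hb'
      have := (Finset.mem_Icc.1 hb).2
      rw [hM b (by omega) (p.1 b)]; simp
    · intro h; exact absurd (Finset.mem_Icc.2 ⟨by omega, le_rfl⟩) h
  · exact p.2 x' (by omega)

/-- the cofree hull at `x` -/
def j0S (M : Rep' k β) (x : ℤ) : Submodule k (∀ x' : ℤ, M.obj.obj x') where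
  carrier := {p | ∀ x', ¬ (x ≤ x' ∧ x' ≤ β x) → p x' = 0}
  add_mem' {p q} hp hq := fun x' h => by simp [hp x' h, hq x' h]
  zero_mem' := fun x' h => rfl
  smul_mem' c p hp := fun x' h => by simp [hp x' h]

def j0r (hβ : Monotone β) (M : Rep' k β) (x y : ℤ) (h : x ≤ y) : j0S M x →ₗ[k] j0S M y where
  toFun p := ⟨fun x' => if y ≤ x' then p.1 x' else 0, fun x' h' => by
    dsimp only
    split_ifs with h1
    · have := hβ h; exact p.2 x' (by grind)
    · rfl⟩
  map_add' p q := by ext x'; simp only [Submodule.coe_add, Pi.add_apply]; split_ifs <;> simp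
  map_smul' c q := by ext x'; simp only [Submodule.coe_smul, Pi.smul_apply, RingHom.id_apply]; split_ifs <;> simp

lemma j0r_apply (hβ : Monotone β) (M : Rep' k β) (x y : ℤ) (h : x ≤ y) (p : j0S M x) (x' : ℤ) :
  (j0r hβ M x y h p).1 x' = if y ≤ x' then p.1 x' else 0 := rfl

noncomputable def J0obj (M : Rep' k β) (hβ : Monotone β) : Rep' k β :=
  mkR (fun x => j0S M x) (j0r hβ M)
    (fun x h p => by
      ext x'; rw [j0r_apply]; split_ifs with h1
      · rfl
      · exact (p.2 x' (by grind)).symm)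
    (fun x y z h h' p => by
      ext x'; rw [j0r_apply, j0r_apply, j0r_apply]; split_ifs <;> first | rfl | grind)
    (fun x y h p hxy => by
      ext x'; rw [j0r_apply]; split_ifs with h1
      · refine p.2 x' ?_
        rintro ⟨h2, h3⟩
        omega
      · rfl)

noncomputable def J0 (hβ : Monotone β) : Rep' k β ⥤ Rep' k β where
  obj M := J0obj M hβ
  map {M N} f := mkH (M := J0obj M hβ) (N := J0obj N hβ) (fun x =>
      ({ toFun p := ⟨fun x' => ev f x' (p.1 x'), fun x' h => by
           dsimp only; rw [p.2 x' h, map_zero]⟩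
         map_add' p q := by ext x'; exact map_add (ev f x') _ _
         map_smul' c p := by ext x'; exact map_smul (ev f x') _ _ } : j0S M x →ₗ[k] j0S N x))
    (fun x y h (m : j0S M x) => by
      apply Subtype.ext
      funext x'
      change ev f x' (if y ≤ x' then m.1 x' else 0) = if y ≤ x' then ev f x' (m.1 x') else 0
      split_ifs
      · rfl
      · exact map_zero _)
  map_id M := ev_ext _ _ fun x m => rfl
  map_comp f g := ev_ext _ _ fun x m => rfl

instance (hβ : Monotone β) : (J0 (k := k) hβ).Additive where
  map_add := ev_ext _ _ fun x m => rfl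

noncomputable def j0e (M : Rep' k β) (x : ℤ) : M.obj.obj x →ₗ[k] j0S M x where
  toFun m := ⟨fun x' => if h : x ≤ x' then res M.obj h m else 0, fun x' h => by
    dsimp only
    split_ifs with h1
    · exact res_zero M h1 (by grind) m
    · rfl⟩
  map_add' p q := by ext x'; simp only [Submodule.coe_add, Pi.add_apply]; split_ifs <;> simp
  map_smul' c q := by ext x'; simp only [Submodule.coe_smul, Pi.smul_apply, RingHom.id_apply]; split_ifs <;> simp

lemma j0e_apply (M : Rep' k β) (x : ℤ) (m : M.obj.obj x) (x' : ℤ) :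
    (j0e M x m).1 x' = if h : x ≤ x' then res M.obj h m else 0 := rfl

noncomputable def J0e (hβ : Monotone β) : 𝟭 (Rep' k β) ⟶ J0 (k := k) hβ where
  app M := mkH (M := M) (N := J0obj M hβ) (fun x => j0e M x) (fun x y h m => by
    change j0e M y (res M.obj h m) = j0r hβ M x y h (j0e M x m)
    apply Subtype.ext
    funext x'
    rw [j0e_apply, j0r_apply]
    split_ifs with h1
    · rw [j0e_apply, dif_pos (h.trans h1), res_res]
    · rfl)
  naturality M N f := ev_ext _ _ fun x m => by
    change j0e N x (ev f x m) = _
    apply Subtype.ext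
    funext x'
    change _ = ev f x' (if h : x ≤ x' then res M.obj h m else 0)
    rw [j0e_apply]
    split_ifs with h
    · rw [res_ev]
    · exact (map_zero _).symm

lemma J0e_mono (hβ : Monotone β) (M : Rep' k β) :
    Mono ((J0e (k := k) hβ).app M) := by
  refine mono_of_ev _ (fun x => ?_)
  rw [injective_iff_map_eq_zero]
  intro m hm
  change j0e M x m = 0 at hm
  have := congrArg (fun p => p.1 x) hm
  rw [j0e_apply, dif_pos le_rfl, res_self] at this
  exact this

lemma J0_coker_zero (hβ : Monotone β) (M : Rep' k β) (c : ℤ)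
    (hM : ∀ x > c, ∀ m : M.obj.obj x, m = 0) (x : ℤ) (hx : c ≤ x)
    (m : ((cokFun (J0e (k := k) hβ)).obj M).obj.obj x) : m = 0 := by
  obtain ⟨p, rfl⟩ := ev_surj_of_epi ((cokFunπ (J0e (k := k) hβ)).app M) x m
  change j0S M x at p
  have : p = ev ((J0e (k := k) hβ).app M) x (p.1 x) := by
    change p = j0e M x (p.1 x)
    apply Subtype.ext
    funext x'
    rw [j0e_apply]
    rcases lt_trichotomy x' x with h | h | h
    · rw [dif_neg (by omega)]
      exact p.2 x' (by omega)
    · subst h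
      rw [dif_pos le_rfl, res_self]
    · rw [dif_pos (by omega)]
      exact (hM x' (by omega) _).trans (hM x' (by omega) _).symm
  rw [this, ← ev_comp, cokFunπ_comp]
  rfl
end
end

section
open CategoryTheory Limits

structure Comb where
  β : ℤ → ℤ
  a : ℤ → ℤ
  w : ℤ
  n : ℤ
  mono : Monotone β
  gc : ∀ u x, u ≤ β x ↔ a u ≤ x
  le : ∀ x, x - 1 ≤ β x
  low : ∀ x < 1, β x < x
  hi : ∀ x > n, β x < x
  split : ∀ x ≤ w, β x < w ∨ β x = β w
  hw : w ≤ β w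

namespace Comb
variable (c : Comb)

def βA (x : ℤ) : ℤ := if x < c.w then min (c.β x) c.w else c.β x
def s (y : ℤ) : ℤ := min (y - 1) (c.w - 1)
def b (y : ℤ) : ℤ := if y ≤ c.w then min (c.β y) c.w else y
def a' (x : ℤ) : ℤ := if x ≤ c.w then c.a x else x
def t (x : ℤ) : ℤ := if x < c.w then x + 1 else c.β x + 1

lemma a_mono {x y : ℤ} (h : x ≤ y) : c.a x ≤ c.a y := by
  rw [← c.gc]; exact h.trans ((c.gc _ _).2 le_rfl)

lemma a_w : c.a c.w ≤ c.w := (c.gc _ _).1 c.hw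
lemma a_le (x : ℤ) : c.a x ≤ x + 1 := (c.gc _ _).1 (by have := c.le (x+1); omega)
lemma a_β (x : ℤ) : c.a (c.β x) ≤ x := (c.gc _ _).1 le_rfl
lemma β_a (x : ℤ) : x ≤ c.β (c.a x) := (c.gc _ _).2 le_rfl

lemma βA_mono : Monotone c.βA := fun x y h => by
  have := c.mono h
  have := c.hw
  unfold βA
  split_ifs with h1 h2 h2
  · omega
  · have := c.mono (not_lt.1 h2); omega
  · omega
  · omega

lemma βA_le (x : ℤ) : c.βA x ≤ c.β x := by unfold βA; split_ifs <;> omega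

lemma βA_low (x : ℤ) (h : x < 1) : c.βA x < x := (c.βA_le x).trans_lt (c.low x h)

lemma s_mono {x y : ℤ} (h : x ≤ y) : c.s x ≤ c.s y := by unfold s; omega
lemma b_mono {x y : ℤ} (h : x ≤ y) : c.b x ≤ c.b y := by
  have := c.mono h
  unfold b; split_ifs <;> omega
lemma s_le_b (y : ℤ) : c.s y ≤ c.b y := by
  have := c.le y
  unfold s b; split_ifs <;> omega
lemma a'_mono {x y : ℤ} (h : x ≤ y) : c.a' x ≤ c.a' y := by
  have := c.a_mono h
  have := c.a_w
  unfold a'; split_ifs with h1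
  · omega
  · have := c.a_mono h1; omega
  · omega
  · omega
lemma t_mono {x y : ℤ} (h : x ≤ y) : c.t x ≤ c.t y := by
  have := c.mono h
  have := c.hw
  unfold t; split_ifs with h1 h2 h2
  · omega
  · have := c.mono (not_lt.1 h2); omega
  · omega
  · omega
lemma a'_le_t (x : ℤ) : c.a' x ≤ c.t x := by
  have := c.a_le x
  have := c.le x
  unfold a' t; split_ifs with h1 h2 h2
  · omega
  · have := c.a_w; have := c.hw
    have e : x = c.w := by omega
    subst e; omega
  · omega
  · omega

lemma le_b_a' (x : ℤ) : x ≤ c.b (c.a' x) := by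
  have := c.β_a x
  have := c.a_w
  unfold b a'; split_ifs with h1 h2
  · omega
  · have := c.a_mono h1; omega
  · omega
lemma a'_b_le (y : ℤ) : c.a' (c.b y) ≤ y := by
  unfold b a'; split_ifs with h1 h2
  · exact (c.gc _ _).1 (min_le_left _ _)
  · omega
  · omega
lemma t_s_le (y : ℤ) : c.t (c.s y) ≤ y := by
  unfold t s; split_ifs <;> omega
lemma le_s_t {x : ℤ} (h : x < c.w) : x ≤ c.s (c.t x) := by
  unfold t s; split_ifs; omega
lemma βA_of_ge {x : ℤ} (h : c.w ≤ x) : c.βA x = c.β x := by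
  unfold βA; rw [if_neg (by omega)]
lemma b_of_le {x : ℤ} (h : x ≤ c.w) : c.b x = min (c.β x) c.w := by
  unfold b; rw [if_pos h]
lemma b_of_gt {x : ℤ} (h : c.w < x) : c.b x = x := by
  unfold b; rw [if_neg (by omega)]
lemma a'_of_le {x : ℤ} (h : x ≤ c.w) : c.a' x = c.a x := by
  unfold a'; rw [if_pos h]
lemma a'_of_gt {x : ℤ} (h : c.w < x) : c.a' x = x := by
  unfold a'; rw [if_neg (by omega)]
lemma βA_le_w {x : ℤ} (h : x < c.w) : c.βA x ≤ c.w := by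
  unfold βA; rw [if_pos h]; omega
lemma s_of_le {x : ℤ} (h : x ≤ c.w) : c.s x = x - 1 := by unfold s; omega
lemma t_of_lt {x : ℤ} (h : x < c.w) : c.t x = x + 1 := by unfold t; rw [if_pos h]
lemma t_of_ge {x : ℤ} (h : c.w ≤ x) : c.t x = c.β x + 1 := by unfold t; rw [if_neg (by omega)]
lemma βA_b_or {x y : ℤ} (hx : x ≤ y) (h : c.β x < y) : c.b x ≤ c.s y ∨ c.βA (c.b x) < c.b y := by
  have hw := c.hw
  by_cases h1 : y ≤ c.w
  · left
    rw [c.b_of_le (by omega)]; unfold s; omega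
  right
  rw [c.b_of_gt (by omega : c.w < y)]
  by_cases h2 : x ≤ c.w
  · rw [c.b_of_le h2]
    rcases c.split x h2 with h3 | h3
    · rw [min_eq_left h3.le]
      have := c.βA_le_w h3
      omega
    · rw [min_eq_right (by omega), c.βA_of_ge le_rfl]; omega
  · rw [c.b_of_gt (by omega), c.βA_of_ge (by omega)]; omega
lemma t_or {x y : ℤ} (hx : x ≤ y) (h : c.βA x < y) : c.t x ≤ c.a' y ∨ c.β (c.a' x) < c.a' y := by
  have hw := c.hw
  by_cases h1 : x < c.w
  · left
    rw [c.t_of_lt h1]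
    by_cases h2 : y ≤ c.w
    · rw [c.a'_of_le h2]
      by_contra h3
      have := (c.gc y x).2 (by omega)
      unfold βA at h; rw [if_pos h1] at h; omega
    · rw [c.a'_of_gt (by omega)]; omega
  · right
    rw [c.βA_of_ge (by omega)] at h
    have := c.le x
    by_cases h2 : x ≤ c.w
    · have e : x = c.w := by omega
      subst e
      rw [c.a'_of_le le_rfl, c.a'_of_gt (by omega)]
      have := c.mono c.a_w
      omega
    · rw [c.a'_of_gt (by omega), c.a'_of_gt (by omega)]; omega
end Comb

section
variable {k : Type} [Field k] (c : Comb)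

abbrev RA := Rep' k c.βA
abbrev RB := Rep' k c.β

variable {c}
noncomputable abbrev fV (M : Rep' k c.βA) (y : ℤ) : Type :=
  (M.obj.obj (c.b y)) ⧸ LinearMap.range (res M.obj (c.s_le_b y))

noncomputable def fr (M : Rep' k c.βA) (x y : ℤ) (h : x ≤ y) : fV M x →ₗ[k] fV M y :=
  Submodule.mapQ _ _ (res M.obj (c.b_mono h)) (by
    rintro _ ⟨z, rfl⟩
    refine ⟨res M.obj (c.s_mono h) z, ?_⟩
    rw [res_res, res_res])

noncomputable def Fobj (M : Rep' k c.βA) : Rep' k c.β :=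
  mkR (fV M) (fr M)
    (fun x h v => by
      obtain ⟨v, rfl⟩ := Submodule.Quotient.mk_surjective _ v
      exact congrArg (Submodule.Quotient.mk) (res_self M.obj _ v))
    (fun x y z h h' v => by
      obtain ⟨v, rfl⟩ := Submodule.Quotient.mk_surjective _ v
      exact congrArg (Submodule.Quotient.mk) (res_res M.obj _ _ v))
    (fun x y h v hxy => by
      obtain ⟨v, rfl⟩ := Submodule.Quotient.mk_surjective _ v
      refine (Submodule.Quotient.mk_eq_zero _).2 ?_
      rcases c.βA_b_or h hxy with h' | h'
      · exact ⟨res M.obj h' v, by rw [res_res]⟩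
      · rw [res_zero M _ h']; exact zero_mem _)

/-- quotient map -/
noncomputable def fq (M : Rep' k c.βA) (y : ℤ) : M.obj.obj (c.b y) →ₗ[k] (Fobj M).obj.obj y :=
  Submodule.mkQ (LinearMap.range (res M.obj (c.s_le_b y)))

lemma fq_surj (M : Rep' k c.βA) (y : ℤ) (f : (Fobj M).obj.obj y) : ∃ m, fq M y m = f :=
  Submodule.Quotient.mk_surjective _ f

lemma fq_eq_zero (M : Rep' k c.βA) (y : ℤ) (m : M.obj.obj (c.b y)) :
    fq M y m = 0 ↔ ∃ z, res M.obj (c.s_le_b y) z = m :=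
  Submodule.Quotient.mk_eq_zero _

lemma res_fq (M : Rep' k c.βA) {x y : ℤ} (h : x ≤ y) (m : M.obj.obj (c.b x)) :
    res (Fobj M).obj h (fq M x m) = fq M y (res M.obj (c.b_mono h) m) := rfl

noncomputable def FF : Rep' k c.βA ⥤ Rep' k c.β where
  obj M := Fobj M
  map {M N} f := mkH (M := Fobj M) (N := Fobj N) (fun y =>
      (Submodule.mapQ _ _ (ev f (c.b y)) (by
        rintro _ ⟨z, rfl⟩
        exact ⟨ev f _ z, (res_ev f _ z).symm⟩) : fV M y →ₗ[k] fV N y))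
    (fun x y h v => by
      obtain ⟨v, rfl⟩ := fq_surj M x v
      exact congrArg (Submodule.Quotient.mk) (res_ev f _ v))
  map_id M := ev_ext _ _ fun x v => by
      obtain ⟨v, rfl⟩ := fq_surj M x v
      rfl
  map_comp {M N L} f g := ev_ext _ _ fun x v => by
      obtain ⟨v, rfl⟩ := fq_surj M x v
      rfl

lemma ev_FF {M N : Rep' k c.βA} (f : M ⟶ N) (y : ℤ) (m : M.obj.obj (c.b y)) :
    ev (FF.map f) y (fq M y m) = fq N y (ev f _ m) := rfl

instance : (FF (k := k) (c := c)).Additive where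
  map_add {M N f g} := ev_ext _ _ fun x v => by
      obtain ⟨v, rfl⟩ := fq_surj M x v
      rfl

noncomputable abbrev gV (N : Rep' k c.β) (x : ℤ) : Submodule k (N.obj.obj (c.a' x)) :=
  LinearMap.ker (res N.obj (c.a'_le_t x))

noncomputable def gr (N : Rep' k c.β) (x y : ℤ) (h : x ≤ y) : gV N x →ₗ[k] gV N y :=
  LinearMap.restrict (res N.obj (c.a'_mono h)) (by
    intro z hz
    have hz : res N.obj (c.a'_le_t x) z = 0 := hz
    change res N.obj (c.a'_le_t y) _ = 0
    rw [res_res, ← res_res N.obj (c.a'_le_t x) (c.t_mono h), hz, map_zero])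

noncomputable def Gobj (N : Rep' k c.β) : Rep' k c.βA :=
  mkR (fun x => gV N x) (gr N)
    (fun x h v => Subtype.ext (res_self N.obj _ v.1))
    (fun x y z h h' v => Subtype.ext (res_res N.obj _ _ v.1))
    (fun x y h v hxy => Subtype.ext (by
      change res N.obj (c.a'_mono h) v.1 = 0
      have hz : res N.obj (c.a'_le_t x) v.1 = 0 := v.2
      rcases c.t_or h hxy with h' | h'
      · rw [← res_res N.obj (c.a'_le_t x) h', hz, map_zero]
      · exact res_zero N _ h' _))

noncomputable def gi (N : Rep' k c.β) (x : ℤ) : (Gobj N).obj.obj x →ₗ[k] N.obj.obj (c.a' x) :=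
  (gV N x).subtype

lemma gi_inj (N : Rep' k c.β) (x : ℤ) (g g' : (Gobj N).obj.obj x) (h : gi N x g = gi N x g') : g = g' :=
  Subtype.ext h

noncomputable def gmk (N : Rep' k c.β) (x : ℤ) (v : N.obj.obj (c.a' x)) (h : res N.obj (c.a'_le_t x) v = 0) :
    (Gobj N).obj.obj x := (⟨v, h⟩ : gV N x)

lemma gi_gmk (N : Rep' k c.β) (x : ℤ) (v : N.obj.obj (c.a' x)) (h) : gi N x (gmk N x v h) = v := rfl

lemma gi_cond (N : Rep' k c.β) (x : ℤ) (g : (Gobj N).obj.obj x) :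
    res N.obj (c.a'_le_t x) (gi N x g) = 0 := g.2

lemma res_gi (N : Rep' k c.β) {x y : ℤ} (h : x ≤ y) (g : (Gobj N).obj.obj x) :
    gi N y (res (Gobj N).obj h g) = res N.obj (c.a'_mono h) (gi N x g) := rfl

noncomputable def GG : Rep' k c.β ⥤ Rep' k c.βA where
  obj M := Gobj M
  map {M N} f := mkH (M := Gobj M) (N := Gobj N) (fun y =>
      (LinearMap.restrict (ev f (c.a' y)) (by
        intro z hz
        have hz : res M.obj (c.a'_le_t y) z = 0 := hz
        change res N.obj (c.a'_le_t y) _ = 0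
        rw [← res_ev, hz, map_zero]) : gV M y →ₗ[k] gV N y))
    (fun x y h v => Subtype.ext (res_ev f _ v.1))
  map_id M := ev_ext _ _ fun x v => rfl
  map_comp {M N L} f g := ev_ext _ _ fun x v => rfl

lemma ev_GG {M N : Rep' k c.β} (f : M ⟶ N) (y : ℤ) (g : (Gobj M).obj.obj y) :
    gi N y (ev (GG.map f) y g) = ev f _ (gi M y g) := rfl

instance : (GG (k := k) (c := c)).Additive where
  map_add {M N f g} := ev_ext _ _ fun x v => rfl

noncomputable def etaApp (M : Rep' k c.βA) : M ⟶ Gobj (Fobj M) :=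
  mkH (M := M) (N := Gobj (Fobj M)) (fun x =>
    (LinearMap.codRestrict (gV (Fobj M) x) (fq M _ ∘ₗ res M.obj (c.le_b_a' x)) (fun m => by
      change res (Fobj M).obj (c.a'_le_t x) (fq M _ (res M.obj _ m)) = 0
      rw [res_fq, res_res, fq_eq_zero]
      by_cases hx : x < c.w
      · exact ⟨res M.obj (c.le_s_t hx) m, by rw [res_res]⟩
      · refine ⟨0, ?_⟩
        rw [map_zero, res_zero]
        rw [c.βA_of_ge (by omega), c.t_of_ge (by omega), c.b_of_gt]
        · omega
        · have := c.hw
          have := c.mono (not_lt.1 hx)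
          omega) : M.obj.obj x →ₗ[k] gV (Fobj M) x))
    (fun x y h m => Subtype.ext (by
      change fq M _ (res M.obj _ (res M.obj _ m)) = res (Fobj M).obj (c.a'_mono h) (fq M _ (res M.obj _ m))
      rw [res_fq, res_res, res_res]))

lemma ev_eta (M : Rep' k c.βA) (x : ℤ) (m : M.obj.obj x) :
    gi _ x (ev (etaApp M) x m) = fq M _ (res M.obj (c.le_b_a' x) m) := rfl

noncomputable def eta : 𝟭 (Rep' k c.βA) ⟶ FF ⋙ GG where
  app M := etaApp M
  naturality M N f := ev_ext _ _ fun x m => gi_inj _ _ _ _ (by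
    change fq N _ (res N.obj _ (ev f x m)) = ev (FF.map f) _ (fq M _ (res M.obj _ m))
    rw [ev_FF, res_ev])

noncomputable def epsApp (N : Rep' k c.β) : Fobj (Gobj N) ⟶ N :=
  mkH (M := Fobj (Gobj N)) (N := N) (fun y =>
    (Submodule.liftQ _ (res N.obj (c.a'_b_le y) ∘ₗ gi N (c.b y)) (by
      rintro _ ⟨z, rfl⟩
      change res N.obj _ (gi N _ (res (Gobj N).obj _ z)) = 0
      rw [res_gi, res_res, ← res_res N.obj (c.a'_le_t (c.s y)) (c.t_s_le y), gi_cond, map_zero]) :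
        fV (Gobj N) y →ₗ[k] N.obj.obj y))
    (fun x y h m => by
      obtain ⟨m, rfl⟩ := fq_surj (Gobj N) x m
      change res N.obj _ (gi N _ (res (Gobj N).obj _ m)) = res N.obj _ (res N.obj _ (gi N _ m))
      rw [res_gi, res_res, res_res])

lemma ev_eps (N : Rep' k c.β) (y : ℤ) (g : (Gobj N).obj.obj (c.b y)) :
    ev (epsApp N) y (fq (Gobj N) y g) = res N.obj (c.a'_b_le y) (gi N _ g) := rfl

noncomputable def eps : GG ⋙ FF ⟶ 𝟭 (Rep' k c.β) where
  app N := epsApp N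
  naturality M N f := ev_ext _ _ fun x m => by
    obtain ⟨m, rfl⟩ := fq_surj (Gobj M) x m
    change res N.obj _ (gi N _ (ev (GG.map f) _ m)) = ev f _ (res M.obj _ (gi M _ m))
    rw [ev_GG, res_ev]
end
end

section
open CategoryTheory Limits

section
variable {k : Type} [Field k] {c : Comb}

variable (k c) in
def EP : ObjectProperty (Rep' k c.βA) := fun M =>
  ∀ (v u : ℤ) (hvu : v ≤ u) (_ : u ≤ c.w) (h : c.a u - 1 ≤ v) (m : M.obj.obj v),
    res M.obj hvu m = 0 → ∃ z, res M.obj h z = m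

variable (k c) in
def YP : ObjectProperty (Rep' k c.β) := fun N =>
  ∀ (v u : ℤ) (hvu : v ≤ u) (_ : u ≤ c.w) (h : u ≤ c.β v + 1) (n : N.obj.obj u),
    (c.β v + 1 ≤ c.w → res N.obj h n = 0) → ∃ z, res N.obj hvu z = n

lemma EP_F (M : Rep' k c.βA) (hM : EP k c M) : YP k c (Fobj M) := by
  intro v u hvu hu h f hf
  obtain ⟨m, rfl⟩ := fq_surj M u f
  have hbu := c.b_of_le hu
  have hbv := c.b_of_le (hvu.trans hu)
  have := c.mono hvu
  by_cases hv : c.w ≤ c.β v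
  · have h1 : c.b u ≤ c.b v := by omega
    refine ⟨fq M v (res M.obj h1 m), ?_⟩
    rw [res_fq, res_res, res_self]
  · have hf := hf (by omega)
    rw [res_fq, fq_eq_zero] at hf
    obtain ⟨z, hz⟩ := hf
    have hby := c.b_of_le (x := c.β v + 1) (by omega)
    have hsy := c.s_of_le (x := c.β v + 1) (by omega)
    have ha : c.a (c.b (c.β v + 1)) ≤ c.β v + 1 := (c.gc _ _).1 (by omega)
    have h1 : c.s (c.β v + 1) ≤ c.b u := by omega
    obtain ⟨z', hz'⟩ := hM (c.b u) (c.b (c.β v + 1)) (c.b_mono h) (by omega) (by omega)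
      (m - res M.obj h1 z) (by rw [map_sub, res_res, hz, sub_self])
    have h2 : c.s (c.β v + 1) ≤ c.b v := by omega
    have h3 : c.a (c.b (c.β v + 1)) - 1 ≤ c.b v := by omega
    refine ⟨fq M v (res M.obj h2 z + res M.obj h3 z'), ?_⟩
    rw [res_fq, map_add, res_res, res_res, hz']
    congr 1
    abel

lemma YP_G (N : Rep' k c.β) (hN : YP k c N) : EP k c (Gobj N) := by
  intro v u hvu hu h g hg
  have hg := congrArg (gi N u) hg
  rw [res_gi, map_zero] at hg
  have e1 := c.a'_of_le hu
  have e3 := c.a_mono hu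
  have e4 := c.a_w
  have e2 := c.a'_of_le (x := c.a u - 1) (by omega)
  have e5 := c.a'_mono hvu
  have e6 := c.β_a (c.a u - 1)
  have e7 := c.t_of_lt (x := c.a u - 1) (by omega)
  rw [← e2] at e6
  obtain ⟨z, hz⟩ := hN (c.a' (c.a u - 1)) (c.a' v) (c.a'_mono h) (by omega) (by omega) (gi N v g)
    (fun _ => by
      have h1 : c.a' u ≤ c.β (c.a' (c.a u - 1)) + 1 := by omega
      rw [← res_res N.obj (c.a'_mono hvu) h1, hg, map_zero])
  refine ⟨gmk N _ z ?_, ?_⟩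
  · have h1 : c.a' u ≤ c.t (c.a u - 1) := by omega
    rw [← res_res N.obj (c.a'_mono (h.trans hvu)) h1, ← res_res N.obj (c.a'_mono h) (c.a'_mono hvu),
      hz, hg, map_zero]
  · apply gi_inj
    rw [res_gi, gi_gmk, hz]

lemma EP_eta (M : Rep' k c.βA) (hM : EP k c M) : IsIso (eta.app M) := by
  refine isIso_of_ev _ (fun x => ⟨?_, ?_⟩)
  · rw [injective_iff_map_eq_zero]
    intro m hm
    change M.obj.obj x at m
    have hm2 : fq M _ (res M.obj (c.le_b_a' x) m) = 0 := congrArg (gi (Fobj M) x) hm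
    rw [fq_eq_zero] at hm2
    obtain ⟨z, hz⟩ := hm2
    change m = 0
    by_cases hx : x ≤ c.w
    · have e1 := c.a'_of_le hx
      have e2 := c.a_w
      have e3 := c.a_mono hx
      have e4 := c.s_of_le (x := c.a' x) (by omega)
      have e5 := c.b_of_le (x := c.a' x) (by omega)
      have e6 := c.a_le x
      have h1 : c.s (c.a' x) ≤ x := by omega
      have hgc := fun y => c.gc x y
      rw [← res_res M.obj h1 (c.le_b_a' x), res_zero M h1, map_zero] at hz
      · have e7 : c.a (c.b (c.a' x)) ≤ c.a' x := (c.gc _ _).1 (by omega)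
        obtain ⟨z', hz'⟩ := hM x _ (c.le_b_a' x) (by omega) (by omega) m hz.symm
        rw [← hz']
        apply res_zero
        refine (c.βA_le _).trans_lt ?_
        have := hgc (c.a (c.b (c.a' x)) - 1)
        omega
      · refine (c.βA_le _).trans_lt ?_
        have := hgc (c.s (c.a' x))
        omega
    · have e1 := c.a'_of_gt (by omega : c.w < x)
      have e2 := c.b_of_gt (x := c.a' x) (by omega)
      have e3 := c.βA_le_w (x := c.s (c.a' x)) (by unfold Comb.s; omega)
      rw [res_zero M _ (by omega)] at hz
      have h1 : c.b (c.a' x) ≤ x := by omega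
      have := congrArg (res M.obj h1) hz
      rw [res_res, res_self, map_zero] at this
      exact this.symm
  · intro g
    change (Gobj (Fobj M)).obj.obj x at g
    obtain ⟨m, hm⟩ := fq_surj M _ (gi (Fobj M) x g)
    suffices h : ∃ m', fq M _ (res M.obj (c.le_b_a' x) m') = fq M _ m by
      obtain ⟨m', hm'⟩ := h
      exact ⟨m', gi_inj _ _ _ _ (hm'.trans hm)⟩
    by_cases hx : x < c.w
    · have hg := gi_cond (Fobj M) x g
      rw [← hm, res_fq, fq_eq_zero] at hg
      obtain ⟨z, hz⟩ := hg
      have e1 := c.a'_of_le hx.le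
      have e2 := c.a_w
      have e3 := c.a_mono hx.le
      have e4 := c.t_of_lt hx
      have e5 := c.s_of_le (x := c.t x) (by omega)
      have e6 := c.b_of_le (x := c.t x) (by omega)
      have e7 := c.le_b_a' x
      have e8 : c.a (c.b (c.t x)) ≤ c.t x := (c.gc _ _).1 (by omega)
      have h1 : c.s (c.t x) ≤ x := by omega
      have h2 : c.a (c.b (c.t x)) - 1 ≤ x := by omega
      obtain ⟨z', hz'⟩ := hM (c.b (c.a' x)) (c.b (c.t x)) (c.b_mono (c.a'_le_t x)) (by omega) (by omega)
        (m - res M.obj (h1.trans e7) z) (by rw [map_sub, res_res, hz, sub_self])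
      refine ⟨res M.obj h1 z + res M.obj h2 z', ?_⟩
      rw [map_add, res_res, res_res, hz']
      congr 1
      abel
    · have h1 : c.b (c.a' x) ≤ x := by
        by_cases h : c.w < x
        · rw [c.a'_of_gt h, c.b_of_gt h]
        · have e : x = c.w := by omega
          have := c.a_w
          subst e
          rw [c.a'_of_le le_rfl, c.b_of_le this]
          omega
      refine ⟨res M.obj h1 m, ?_⟩
      rw [res_res, res_self]

lemma YP_eps (N : Rep' k c.β) (hN : YP k c N) : IsIso (eps.app N) := by
  refine isIso_of_ev _ (fun y => ⟨?_, ?_⟩)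
  · rw [injective_iff_map_eq_zero]
    intro f hf
    change (Fobj (Gobj N)).obj.obj y at f
    obtain ⟨g, rfl⟩ := fq_surj (Gobj N) y f
    have hf : res N.obj (c.a'_b_le y) (gi N _ g) = 0 := hf
    by_cases hy : y ≤ c.w
    · refine (fq_eq_zero _ _ _).2 ?_
      have e1 := c.s_of_le hy
      have e2 := c.a'_of_le (x := c.s y) (by omega)
      have e3 := c.β_a (c.s y)
      have e4 := c.a'_b_le y
      have e5 := c.t_of_lt (x := c.s y) (by omega)
      rw [← e2] at e3
      obtain ⟨z, hz⟩ := hN (c.a' (c.s y)) (c.a' (c.b y)) (c.a'_mono (c.s_le_b y)) (by omega) (by omega)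
        (gi N _ g) (fun _ => by
          have h1 : y ≤ c.β (c.a' (c.s y)) + 1 := by omega
          rw [← res_res N.obj e4 h1, hf, map_zero])
      refine ⟨gmk N _ z ?_, ?_⟩
      · have h1 : y ≤ c.t (c.s y) := by omega
        rw [← res_res N.obj ((c.a'_mono (c.s_le_b y)).trans e4) h1,
          ← res_res N.obj (c.a'_mono (c.s_le_b y)) e4, hz, hf, map_zero]
      · apply gi_inj
        rw [res_gi, gi_gmk, hz]
    · have e1 := c.b_of_gt (by omega : c.w < y)
      have e2 := c.a'_of_gt (by omega : c.w < c.b y)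
      have h1 : y ≤ c.a' (c.b y) := by omega
      have := congrArg (res N.obj h1) hf
      rw [res_res, res_self, map_zero] at this
      have hg : g = 0 := gi_inj _ _ _ _ (this.trans (map_zero _).symm)
      subst hg
      exact map_zero _
  · intro n
    suffices h : ∃ z : N.obj.obj (c.a' (c.b y)), res N.obj (c.a'_b_le y) z = n ∧
        res N.obj (c.a'_le_t (c.b y)) z = 0 by
      obtain ⟨z, hz, hz'⟩ := h
      exact ⟨fq (Gobj N) y (gmk N _ z hz'), hz⟩
    have e4 := c.a'_b_le y
    by_cases hy : y ≤ c.w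
    · have e1 := c.b_of_le hy
      have e2 := c.a'_of_le (x := c.b y) (by omega)
      have e3 := c.β_a (c.b y)
      have e5 := c.mono e4
      have e6 := c.le y
      have e7 := c.hw
      rw [← e2] at e3
      obtain ⟨z, hz⟩ := hN _ y e4 hy (by omega) n (fun h => by
        refine res_zero N _ ?_ n
        omega)
      refine ⟨z, hz, res_zero N _ ?_ _⟩
      rcases c.split y hy with h | h
      · rw [c.t_of_lt (x := c.b y) (by omega)]; omega
      · have : c.b y = c.w := by omega
        have ht : c.t (c.b y) = c.β c.w + 1 := by rw [this, c.t_of_ge le_rfl]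
        omega
    · have e1 := c.b_of_gt (by omega : c.w < y)
      have e2 := c.a'_of_gt (by omega : c.w < c.b y)
      have h1 : y ≤ c.a' (c.b y) := by omega
      refine ⟨res N.obj h1 n, ?_, ?_⟩
      · rw [res_res, res_self]
      · rw [res_res]
        apply res_zero
        rw [e1, c.t_of_ge (by omega)]; omega

lemma acyclic_iff' {β : ℤ → ℤ} (K : CochainComplex (Rep' k β) ℤ) : K.Acyclic ↔
    ∀ (i j l : ℤ), i + 1 = j → j + 1 = l → ∀ (x : ℤ) (m : (K.X j).obj.obj x), ev (K.d j l) x m = 0 →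
      ∃ m' : (K.X i).obj.obj x, ev (K.d i j) x m' = m := by
  rw [acyclic_iff_ev]
  constructor
  · intro h i j l hij hjl x m hm
    obtain rfl : i = j - 1 := by omega
    subst hjl
    exact h j x m hm
  · intro h i x m hm
    exact h (i-1) i (i+1) (by omega) rfl x m hm

lemma dd {β : ℤ → ℤ} (K : CochainComplex (Rep' k β) ℤ) (i j l : ℤ) (x : ℤ) (m : (K.X i).obj.obj x) :
    ev (K.d j l) x (ev (K.d i j) x m) = 0 := by
  rw [← ev_comp, K.d_comp_d]; rfl

lemma claimA (K : CochainComplex (Rep' k c.βA) ℤ) (hE : ∀ i, EP k c (K.X i)) (hK : K.Acyclic)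
    (N : ℕ) : ∀ (v u i j l : ℤ) (_ : v ≤ N) (_ : i + 1 = j) (_ : j + 1 = l) (hvu : v ≤ u)
      (_ : u ≤ c.w) (m : (K.X j).obj.obj v),
      res (K.X l).obj hvu (ev (K.d j l) v m) = 0 → ∃ m' : (K.X i).obj.obj v,
        res (K.X j).obj hvu (m - ev (K.d i j) v m') = 0 := by
  induction N with
  | zero =>
    intro v u i j l hv hij hjl hvu hu m hm
    refine ⟨0, ?_⟩
    rw [rep_zero (K.X j) (c.βA_low v (by push_cast at hv; omega)) m]; simp
  | succ N ih =>
    intro v u i j l hv hij hjl hvu hu m hm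
    by_cases hau : v ≤ c.a u - 1
    · refine ⟨0, res_zero _ _ ((c.βA_le v).trans_lt ?_) _⟩
      have := c.gc u v
      omega
    have h : c.a u - 1 ≤ v := by omega
    obtain ⟨z, hz⟩ := hE l v u hvu hu h _ hm
    obtain ⟨z', hz'⟩ := ih (c.a u - 1) v j l (l+1) (by push_cast at hv; omega) hjl rfl h (by omega) z
      (by rw [← res_ev, hz, dd])
    rw [map_sub, hz, ← res_ev, sub_eq_zero] at hz'
    obtain ⟨m', hm'⟩ := (acyclic_iff' K).1 hK i j l hij hjl v (m - res (K.X j).obj h z')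
      (by rw [map_sub, hz', sub_self])
    refine ⟨m', ?_⟩
    rw [hm', sub_sub_cancel, res_res]
    refine res_zero _ _ ((c.βA_le _).trans_lt ?_) _
    have := c.gc u (c.a u - 1)
    omega

lemma acyclic_F (K : CochainComplex (Rep' k c.βA) ℤ) (hE : ∀ i, EP k c (K.X i)) (hK : K.Acyclic) :
    ((FF.mapHomologicalComplex (ComplexShape.up ℤ)).obj K).Acyclic := by
  rw [acyclic_iff']
  intro i j l hij hjl y f hf
  change (Fobj (K.X j)).obj.obj y at f
  obtain ⟨m, rfl⟩ := fq_surj (K.X j) y f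
  have hf : fq (K.X l) y (ev (K.d j l) _ m) = 0 := hf
  rw [fq_eq_zero] at hf
  obtain ⟨z, hz⟩ := hf
  suffices h : ∃ m', fq (K.X j) y (ev (K.d i j) _ m') = fq (K.X j) y m by
    obtain ⟨m', hm'⟩ := h
    exact ⟨fq (K.X i) y m', hm'⟩
  by_cases hy : y ≤ c.w
  · have e1 := c.b_of_le hy
    obtain ⟨z', hz'⟩ := claimA K hE hK (c.s y).toNat (c.s y) (c.b y) j l (l+1) (by omega) hjl rfl (c.s_le_b y)
      (by omega) z (by rw [← res_ev, hz, dd])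
    rw [map_sub, hz, ← res_ev, sub_eq_zero] at hz'
    obtain ⟨m', hm'⟩ := (acyclic_iff' K).1 hK i j l hij hjl _ (m - res (K.X j).obj (c.s_le_b y) z')
      (by rw [map_sub, hz', sub_self])
    refine ⟨m', ?_⟩
    rw [hm', map_sub, (fq_eq_zero _ _ _).2 ⟨z', rfl⟩, sub_zero]
  · have e1 := c.βA_le_w (x := c.s y) (by unfold Comb.s; omega)
    have e2 := c.b_of_gt (by omega : c.w < y)
    rw [res_zero _ _ (by omega)] at hz
    obtain ⟨m', hm'⟩ := (acyclic_iff' K).1 hK i j l hij hjl _ m hz.symm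
    exact ⟨m', by rw [hm']⟩

lemma claimB (K : CochainComplex (Rep' k c.β) ℤ) (hY : ∀ i, YP k c (K.X i)) (hK : K.Acyclic)
    (N : ℕ) : ∀ (v u i j l : ℤ) (_ : c.w - u ≤ N) (_ : i + 1 = j) (_ : j + 1 = l) (hvu : v ≤ u)
      (_ : u ≤ c.w) (m : (K.X j).obj.obj v),
      res (K.X l).obj hvu (ev (K.d j l) v m) = 0 → ∃ q : (K.X i).obj.obj v,
        res (K.X j).obj hvu (ev (K.d i j) v q) = res (K.X j).obj hvu m := by
  induction N with
  | zero =>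
    intro v u i j l hv hij hjl hvu hu m hm
    by_cases hβ : c.β v < u
    · exact ⟨0, (res_zero _ _ hβ _).trans (res_zero _ _ hβ _).symm⟩
    obtain ⟨n', hn'⟩ := (acyclic_iff' K).1 hK i j l hij hjl u (res (K.X j).obj hvu m) (by rw [res_ev, hm])
    obtain ⟨q, hq⟩ := hY i v u hvu hu (by omega) n' (fun h => by push_cast at hv; omega)
    exact ⟨q, by rw [← res_ev, hq, hn']⟩
  | succ N ih =>
    intro v u i j l hv hij hjl hvu hu m hm
    by_cases hβ : c.β v < u
    · exact ⟨0, (res_zero _ _ hβ _).trans (res_zero _ _ hβ _).symm⟩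
    obtain ⟨n', hn'⟩ := (acyclic_iff' K).1 hK i j l hij hjl u (res (K.X j).obj hvu m) (by rw [res_ev, hm])
    have hu1 : u ≤ c.β v + 1 := by omega
    by_cases hy : c.β v + 1 ≤ c.w
    · obtain ⟨q', hq'⟩ := ih u (c.β v + 1) (i-1) i j (by push_cast at hv; omega) (by omega) hij hu1 hy n' (by
        rw [hn', res_res]
        exact res_zero _ _ (by omega) _)
      obtain ⟨q, hq⟩ := hY i v u hvu hu hu1 (n' - ev (K.d (i-1) i) u q') (fun _ => by
        rw [map_sub, hq', sub_self])
      refine ⟨q, ?_⟩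
      rw [← res_ev, hq, map_sub, dd, sub_zero, hn']
    · obtain ⟨q, hq⟩ := hY i v u hvu hu hu1 n' (fun h => absurd h hy)
      exact ⟨q, by rw [← res_ev, hq, hn']⟩

lemma acyclic_G (K : CochainComplex (Rep' k c.β) ℤ) (hY : ∀ i, YP k c (K.X i)) (hK : K.Acyclic) :
    ((GG.mapHomologicalComplex (ComplexShape.up ℤ)).obj K).Acyclic := by
  rw [acyclic_iff']
  intro i j l hij hjl x g hg
  change (Gobj (K.X j)).obj.obj x at g
  have hg : ev (K.d j l) _ (gi (K.X j) x g) = 0 := congrArg (gi (K.X l) x) hg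
  obtain ⟨n, hn⟩ := (acyclic_iff' K).1 hK i j l hij hjl _ _ hg
  suffices h : ∃ n' : (K.X i).obj.obj (c.a' x), ev (K.d i j) _ n' = gi (K.X j) x g ∧
      res (K.X i).obj (c.a'_le_t x) n' = 0 by
    obtain ⟨n', h1, h2⟩ := h
    exact ⟨gmk (K.X i) x n' h2, gi_inj _ _ _ _ h1⟩
  by_cases hx : x < c.w
  · have e1 := c.t_of_lt hx
    obtain ⟨q, hq⟩ := claimB K hY hK (c.w - c.t x).toNat (c.a' x) (c.t x) (i-1) i j (by omega) (by omega) hij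
      (c.a'_le_t x) (by omega) n (by rw [hn, gi_cond])
    refine ⟨n - ev (K.d (i-1) i) _ q, ?_, ?_⟩
    · rw [map_sub, dd, sub_zero, hn]
    · rw [map_sub, hq, sub_self]
  · refine ⟨n, hn, res_zero _ _ ?_ _⟩
    rw [c.t_of_ge (by omega)]
    have : c.a' x ≤ x := by
      by_cases h : c.w < x
      · rw [c.a'_of_gt h]
      · have e : x = c.w := by omega
        subst e
        rw [c.a'_of_le le_rfl]; exact c.a_w
    have := c.mono this
    omega

lemma acyclic_F_iff (K : CochainComplex (Rep' k c.βA) ℤ) (hE : ∀ i, EP k c (K.X i)) :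
    K.Acyclic ↔ ((FF.mapHomologicalComplex (ComplexShape.up ℤ)).obj K).Acyclic := by
  refine ⟨acyclic_F K hE, fun h => ?_⟩
  have h2 := acyclic_G _ (fun i => EP_F _ (hE i)) h
  rw [acyclic_iff'] at h2 ⊢
  intro i j l hij hjl x m hm
  have hbij : ∀ i, Function.Bijective (ev (eta.app (K.X i)) x) := fun i => by
    have := EP_eta _ (hE i)
    exact ⟨ev_inj_of_mono _ x, ev_surj_of_epi _ x⟩
  have hnat : ∀ i j m, ev (eta.app (K.X j)) x (ev (K.d i j) x m) =
      ev ((FF ⋙ GG).map (K.d i j)) x (ev (eta.app (K.X i)) x m) := fun i j m => by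
    rw [← ev_comp, ← ev_comp]
    exact congrArg (fun f => ev f x m) (eta.naturality (K.d i j))
  obtain ⟨g, hg⟩ := h2 i j l hij hjl x (ev (eta.app (K.X j)) x m)
    ((hnat j l m).symm.trans ((congrArg (ev (eta.app (K.X l)) x) hm).trans (map_zero _)))
  obtain ⟨m', rfl⟩ := (hbij i).2 g
  exact ⟨m', (hbij j).1 ((hnat i j m').trans hg)⟩
end
end

section
open CategoryTheory Limits
open scoped ZeroObject

section
variable {k : Type} [Field k] {c : Comb}

lemma EP_retract2 {M N L : Rep' k c.βA} (i₁ : M ⟶ L) (p₁ : L ⟶ M) (i₂ : N ⟶ L) (p₂ : L ⟶ N)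
    (h : p₁ ≫ i₁ + p₂ ≫ i₂ = 𝟙 L) (hM : EP k c M) (hN : EP k c N) : EP k c L := by
  intro v u hvu hu ha m hm
  obtain ⟨z₁, h₁⟩ := hM v u hvu hu ha (ev p₁ v m) (by rw [← res_ev, hm, map_zero])
  obtain ⟨z₂, h₂⟩ := hN v u hvu hu ha (ev p₂ v m) (by rw [← res_ev, hm, map_zero])
  refine ⟨ev i₁ _ z₁ + ev i₂ _ z₂, ?_⟩
  rw [map_add, ← res_ev, ← res_ev, h₁, h₂, ← ev_comp, ← ev_comp, ← ev_add, h, ev_id]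

lemma YP_retract2 {M N L : Rep' k c.β} (i₁ : M ⟶ L) (p₁ : L ⟶ M) (i₂ : N ⟶ L) (p₂ : L ⟶ N)
    (h : p₁ ≫ i₁ + p₂ ≫ i₂ = 𝟙 L) (hM : YP k c M) (hN : YP k c N) : YP k c L := by
  intro v u hvu hu ha m hm
  obtain ⟨z₁, h₁⟩ := hM v u hvu hu ha (ev p₁ u m) (fun hw => by rw [← res_ev, hm hw, map_zero])
  obtain ⟨z₂, h₂⟩ := hN v u hvu hu ha (ev p₂ u m) (fun hw => by rw [← res_ev, hm hw, map_zero])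
  refine ⟨ev i₁ _ z₁ + ev i₂ _ z₂, ?_⟩
  rw [map_add, ← res_ev, ← res_ev, h₁, h₂, ← ev_comp, ← ev_comp, ← ev_add, h, ev_id]

instance : (EP k c).IsClosedUnderIsomorphisms where
  of_iso e h := EP_retract2 e.hom e.inv 0 0 (by simp) h h

instance : (YP k c).IsClosedUnderIsomorphisms where
  of_iso e h := YP_retract2 e.hom e.inv 0 0 (by simp) h h

lemma EP_of_zero (M : Rep' k c.βA) (h : ∀ x ≤ c.w, ∀ m : M.obj.obj x, m = 0) : EP k c M := by
  intro v u hvu hu ha m hm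
  exact ⟨0, by rw [map_zero, h v (hvu.trans hu) m]⟩

lemma YP_of_zero (M : Rep' k c.β) (h : ∀ x, ∀ m : M.obj.obj x, m = 0) : YP k c M := by
  intro v u hvu hu ha m hm
  exact ⟨0, by rw [map_zero, h u m]⟩

instance : (EP k c).ContainsZero where
  exists_zero := by
    refine ⟨_, isZero_zero _, EP_of_zero _ (fun x _ m => ?_)⟩
    have := (evF_isZero_iff (0 : Rep' k c.βA)).1 (isZero_zero _) x
    exact (ModuleCat.subsingleton_of_isZero this).elim m 0

lemma EP_P0 (M : Rep' k c.βA) : EP k c ((P0 c.βA_mono).obj M) := by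
  intro v u hvu hu ha (p : p0S M v) hp
  have hp : p0r M v u hvu p = 0 := hp
  have key : ∀ x', p.1 x' ≠ 0 → x' ≤ c.a u - 1 ∧ v ≤ c.βA x' := fun x' hx' => by
    have h1 : x' ≤ v ∧ v ≤ c.βA x' := by
      by_contra h; exact hx' (p.2 x' h)
    have h2 : ¬ u ≤ c.βA x' := fun h => by
      have := congrArg (fun p => p.1 x') hp
      rw [p0r_apply, if_pos h] at this
      exact hx' this
    refine ⟨?_, h1.2⟩
    have := c.gc u x'
    have := c.hw
    unfold Comb.βA at h2
    split_ifs at h2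
    · omega
    · have e : x' = c.w := by omega
      subst e
      omega
  refine ⟨(⟨p.1, fun x' h => ?_⟩ : p0S M (c.a u - 1)), ?_⟩
  · by_contra h'
    have := key x' h'
    omega
  · change p0r M _ v ha _ = p
    apply Subtype.ext
    funext x'
    rw [p0r_apply]
    split_ifs with h
    · rfl
    · by_contra h'
      exact h (key x' (fun e => h' e.symm)).2

lemma YP_J0 (M : Rep' k c.β) : YP k c ((J0 c.mono).obj M) := by
  intro v u hvu hu ha (p : j0S M u) hp
  have hp : c.β v + 1 ≤ c.w → j0r c.mono M u _ ha p = 0 := hp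
  have key : ∀ x', p.1 x' ≠ 0 → u ≤ x' ∧ x' ≤ c.β v := fun x' hx' => by
    have h1 : u ≤ x' ∧ x' ≤ c.β u := by
      by_contra h; exact hx' (p.2 x' h)
    refine ⟨h1.1, ?_⟩
    by_cases hw : c.β v + 1 ≤ c.w
    · by_contra h
      have := congrArg (fun p => p.1 x') (hp hw)
      rw [j0r_apply, if_pos (by omega)] at this
      exact hx' this
    · have := c.split v (by omega)
      have := c.mono hu
      omega
  refine ⟨(⟨p.1, fun x' h => ?_⟩ : j0S M v), ?_⟩
  · by_contra h'
    have := key x' h'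
    omega
  · change j0r c.mono M v u hvu _ = p
    apply Subtype.ext
    funext x'
    rw [j0r_apply]
    split_ifs with h
    · rfl
    · by_contra h'
      exact h (key x' (fun e => h' e.symm)).1

lemma EP_syz (m : ℕ) : ∀ (d : ℤ) (_ : c.w < d + m) (M : Rep' k c.βA)
    (_ : ∀ x < d, ∀ m : M.obj.obj x, m = 0), syzIter (kerFun (P0e c.βA_mono)) (EP k c) m M := by
  induction m with
  | zero =>
    intro d hd M hM
    exact EP_of_zero M (fun x hx => hM x (by push_cast at hd; omega))
  | succ m ih =>
    intro d hd M hM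
    exact ih (d+1) (by push_cast at hd; omega) _
      (fun x hx => P0_ker_zero c.βA_mono c.βA_low M d hM x (by omega))

lemma YP_syz (m : ℕ) : ∀ (d : ℤ) (_ : d - m < 1) (M : Rep' k c.β)
    (_ : ∀ x > d, ∀ m : M.obj.obj x, m = 0), syzIter (cokFun (J0e c.mono)) (YP k c) m M := by
  induction m with
  | zero =>
    intro d hd M hM
    refine YP_of_zero M (fun x => ?_)
    by_cases h : x < 1
    · exact rep_zero M (c.low x h)
    · exact hM x (by push_cast at hd; omega)
  | succ m ih =>
    intro d hd M hM
    exact ih (d-1) (by push_cast at hd; omega) _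
      (fun x hx => J0_coker_zero c.mono M d hM x (by omega))

variable (k c) in
theorem triEq_comb [HasDerivedCategory (Rep' k c.βA)] [HasDerivedCategory (Rep' k c.β)] :
    TriEq (Rep' k c.βA) (Rep' k c.β) :=
  packaged (EP k c) (YP k c)
    (fun _ _ h h' => EP_retract2 biprod.inl biprod.fst biprod.inr biprod.snd biprod.total h h')
    (fun _ _ h h' => YP_retract2 biprod.inl biprod.fst biprod.inr biprod.snd biprod.total h h')
    FF GG EP_F YP_G eta eps EP_eta YP_eps
    (kerFun (P0e c.βA_mono)) (P0 c.βA_mono) (kerFunι _) (P0e c.βA_mono) (kerFunι_comp _)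
    (kerFun_shortExact _ (P0e_epi c.βA_mono c.βA_low)) EP_P0 (c.w).toNat
    (fun M => EP_syz _ 1 (by omega) M (fun x hx => rep_zero M (c.βA_low x hx)))
    (J0 c.mono) (cokFun (J0e c.mono)) (J0e c.mono) (cokFunπ _) (cokFunπ_comp _)
    (cokFun_shortExact _ (J0e_mono c.mono)) YP_J0 (c.n).toNat
    (fun M => YP_syz _ c.n (by omega) M (fun x hx => rep_zero M (c.hi x hx)))
    acyclic_F_iff
end
end

section
open CategoryTheory Limits MulOpposite

section
variable {k : Type} [Field k] {A : Type} [Ring A] [Algebra k A]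

/-- the product of consecutive arrows -/
def pth (e a : ℤ → A) (x : ℤ) : ℕ → A
  | 0 => e x
  | (d + 1) => pth e a x d * a (x + d)

/-- the path from `x` to `y` -/
def pt (e a : ℤ → A) (x y : ℤ) : A := pth e a x (y - x).toNat

lemma pt_self (e a : ℤ → A) (x : ℤ) : pt e a x x = e x := by
  unfold pt; simp [pth]

lemma pt_succ (e a : ℤ → A) {x y : ℤ} (h : x ≤ y) : pt e a x (y+1) = pt e a x y * a y := by
  unfold pt
  have : (y + 1 - x).toNat = (y - x).toNat + 1 := by omega
  rw [this, pth]
  congr 2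
  omega

variable (A) in
structure LinData (β : ℤ → ℤ) (n : ℤ) where
  e : ℤ → A
  a : ℤ → A
  idem : ∀ x, e x * e x = e x
  orth : ∀ x y, x ≠ y → e x * e y = 0
  sum : ∑ x ∈ Finset.Icc 1 n, e x = 1
  src : ∀ x, e x * a x = a x
  tgt : ∀ x, a x * e (x+1) = a x
  zero : ∀ x y, x ≤ y → β x < y → pt e a x y = 0

namespace LinData
variable {β : ℤ → ℤ} {n : ℤ} (D : LinData A β n)

abbrev p (x y : ℤ) : A := pt D.e D.a x y

lemma p_e {x y : ℤ} (h : x ≤ y) : D.p x y * D.e y = D.p x y := by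
  induction y, h using Int.le_induction with
  | base => rw [p, pt_self, D.idem]
  | succ y h ih => rw [p, pt_succ _ _ h, mul_assoc, D.tgt]

lemma e_p {x y : ℤ} (h : x ≤ y) : D.e x * D.p x y = D.p x y := by
  induction y, h using Int.le_induction with
  | base => rw [p, pt_self, D.idem]
  | succ y h ih => rw [p, pt_succ _ _ h, ← mul_assoc, ih]

lemma p_p {x y z : ℤ} (h : x ≤ y) (h' : y ≤ z) : D.p x y * D.p y z = D.p x z := by
  induction z, h' using Int.le_induction with
  | base => rw [p, p, pt_self, D.p_e h]
  | succ z h' ih => rw [p, p, p, pt_succ _ _ h', ← mul_assoc, ih, pt_succ _ _ (h.trans h')]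

lemma p_succ (x : ℤ) : D.p x (x+1) = D.a x := by
  rw [p, pt_succ _ _ le_rfl, pt_self, D.src]

lemma e_zero {x : ℤ} (h : β x < x) : D.e x = 0 := by
  rw [← pt_self D.e D.a, D.zero x x le_rfl h]
end LinData

noncomputable instance opModule (M : ModuleCat.{0} Aᵐᵒᵖ) : Module k M :=
  ModuleCat.moduleOfAlgebraModule M

instance opTower (M : ModuleCat.{0} Aᵐᵒᵖ) : IsScalarTower k Aᵐᵒᵖ M :=
  ModuleCat.isScalarTower_of_algebra_moduleCat M

variable (k) in
/-- the right action -/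
noncomputable def act (M : ModuleCat.{0} Aᵐᵒᵖ) (a : A) : M →ₗ[k] M := Algebra.lsmul k k M (op a)

section
variable (M N : ModuleCat.{0} Aᵐᵒᵖ)
lemma act_def (a : A) (m : M) : act k M a m = op a • m := rfl
lemma act_mul (a b : A) (m : M) : act k M (a * b) m = act k M b (act k M a m) := by
  simp only [act_def, MulOpposite.op_mul, mul_smul]
lemma act_one (m : M) : act k M 1 m = m := by
  simp only [act_def, MulOpposite.op_one, one_smul]
lemma act_zero (m : M) : act k M 0 m = 0 := by
  simp only [act_def, MulOpposite.op_zero, zero_smul]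
lemma act_add (a b : A) (m : M) : act k M (a + b) m = act k M a m + act k M b m := by
  simp only [act_def, MulOpposite.op_add, add_smul]
lemma act_algebraMap (c : k) (m : M) : act k M (algebraMap k A c) m = c • m := by
  rw [act_def, ← MulOpposite.algebraMap_apply]
  exact algebraMap_smul _ c m
lemma act_sum {ι : Type} (s : Finset ι) (f : ι → A) (m : M) :
    act k M (∑ i ∈ s, f i) m = ∑ i ∈ s, act k M (f i) m := by
  simp only [act_def, Finset.op_sum, Finset.sum_smul]
variable {M N}
lemma act_hom (f : M ⟶ N) (a : A) (m : M) : f.hom (act k M a m) = act k N a (f.hom m) := by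
  simp only [act_def, map_smul]
lemma hom_smul (f : M ⟶ N) (a : k) (m : M) : f.hom (a • m) = a • (f.hom m) := by
  rw [← act_algebraMap, ← act_algebraMap, act_hom]
end

variable {β : ℤ → ℤ} {n : ℤ} (D : LinData A β n)

variable (k) in
/-- vertex spaces -/
noncomputable def eS (M : ModuleCat.{0} Aᵐᵒᵖ) (x : ℤ) : Submodule k M :=
  LinearMap.eqLocus (act k M (D.e x)) LinearMap.id

lemma mem_eS (M : ModuleCat.{0} Aᵐᵒᵖ) (x : ℤ) (m : M) : m ∈ eS k D M x ↔ act k M (D.e x) m = m := Iff.rfl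

lemma e_mem (M : ModuleCat.{0} Aᵐᵒᵖ) (x : ℤ) (m : M) : act k M (D.e x) m ∈ eS k D M x := by
  rw [mem_eS, ← act_mul, D.idem]

noncomputable def eR (M : ModuleCat.{0} Aᵐᵒᵖ) (x y : ℤ) (h : x ≤ y) : eS k D M x →ₗ[k] eS k D M y :=
  LinearMap.restrict (act k M (D.p x y)) (fun m _ => by rw [mem_eS, ← act_mul, D.p_e h])

variable (k) in
noncomputable def phiObj (M : ModuleCat.{0} Aᵐᵒᵖ) : Rep' k β :=
  mkR (fun x => eS k D M x) (eR D M)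
    (fun x h v => Subtype.ext (by
      change act k M (D.p x x) v.1 = v.1
      rw [LinData.p, pt_self]; exact v.2))
    (fun x y z h h' v => Subtype.ext (by
      change act k M (D.p y z) (act k M (D.p x y) v.1) = act k M (D.p x z) v.1
      rw [← act_mul, D.p_p h h']))
    (fun x y h v hxy => Subtype.ext (by
      change act k M (pt D.e D.a x y) v.1 = 0
      rw [D.zero x y h hxy, act_zero]))

variable (k) in
noncomputable def phi : ModuleCat.{0} Aᵐᵒᵖ ⥤ Rep' k β where
  obj M := phiObj k D M
  map {M N} f := mkH (M := phiObj k D M) (N := phiObj k D N) (fun x =>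
      ({ toFun m := ⟨f.hom m.1, by rw [mem_eS, ← act_hom]; exact congrArg f.hom m.2⟩
         map_add' p q := Subtype.ext (map_add f.hom _ _)
         map_smul' c p := Subtype.ext (hom_smul f _ _) } : eS k D M x →ₗ[k] eS k D N x))
    (fun x y h m => Subtype.ext (act_hom (k := k) f _ _))
  map_id M := ev_ext _ _ fun x m => rfl
  map_comp f g := ev_ext _ _ fun x m => rfl

lemma sum_e (M : ModuleCat.{0} Aᵐᵒᵖ) (m : M) : ∑ x ∈ Finset.Icc 1 n, act k M (D.e x) m = m := by
  rw [← act_sum, D.sum, act_one]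

instance phi_faithful : (phi k D).Faithful where
  map_injective {M N f g} h := by
    ext m
    rw [← sum_e (k := k) D M m, map_sum, map_sum]
    refine Finset.sum_congr rfl (fun x _ => ?_)
    have := congrArg (fun f => ev f x (⟨_, e_mem D M x m⟩ : eS k D M x)) h
    exact congrArg Subtype.val this

lemma phi_full (hgen : Algebra.adjoin k (Set.range D.e ∪ Set.range D.a) = ⊤)
    (hout : ∀ x, x ∉ Finset.Icc 1 n → β x < x) : (phi k D).Full where
  map_surjective {M N} g := by
    let gg : ∀ x, eS k D M x →ₗ[k] eS k D N x := fun x => ev g x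
    have hgg : ∀ x y (h : x ≤ y) m, gg y (eR D M x y h m) = eR D N x y h (gg x m) := fun x y h m =>
      res_ev g h m
    let f : M →ₗ[k] N := ∑ x ∈ Finset.Icc 1 n, (eS k D N x).subtype ∘ₗ gg x ∘ₗ
      LinearMap.codRestrict (eS k D M x) (act k M (D.e x)) (e_mem D M x)
    have hf : ∀ m, f m = ∑ x ∈ Finset.Icc 1 n, (gg x ⟨act k M (D.e x) m, e_mem D M x m⟩).1 := fun m => by
      simp only [f, LinearMap.sum_apply]
      rfl
    have hf1 : ∀ x (m : eS k D M x), f m.1 = (gg x m).1 := fun x m => by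
      rw [hf]
      by_cases hx : x ∈ Finset.Icc 1 n
      · rw [Finset.sum_eq_single_of_mem x hx]
        · congr 2
          exact Subtype.ext m.2
        · intro y _ hy
          have : (⟨act k M (D.e y) m.1, e_mem D M y m.1⟩ : eS k D M y) = 0 := Subtype.ext (by
            have h1 : act k M (D.e x) m.1 = m.1 := m.2
            change act k M (D.e y) m.1 = 0
            rw [← h1, ← act_mul, D.orth _ _ hy.symm, act_zero])
          rw [this, map_zero]; rfl
      · have hm : m = 0 := Subtype.ext (by
          have h1 : act k M (D.e x) m.1 = m.1 := m.2
          rw [D.e_zero (hout x hx), act_zero] at h1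
          exact h1.symm)
        subst hm
        rw [map_zero]
        rw [← hf]; exact map_zero f
    have hlin : ∀ (a : A) (m : M), f (act k M a m) = act k N a (f m) := by
      intro a
      have ha : a ∈ Algebra.adjoin k (Set.range D.e ∪ Set.range D.a) := by rw [hgen]; trivial
      induction ha using Algebra.adjoin_induction with
      | mem a ha =>
        suffices h : ∀ x (m : eS k D M x), f (act k M a m.1) = act k N a (f m.1) by
          intro m
          rw [← sum_e (k := k) D M m]
          simp only [map_sum]
          exact Finset.sum_congr rfl (fun x _ => h x ⟨_, e_mem D M x m⟩)
        intro x m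
        have h1 : act k M (D.e x) m.1 = m.1 := m.2
        have h2 : act k N (D.e x) (gg x m).1 = (gg x m).1 := (gg x m).2
        rw [hf1]
        rcases ha with ⟨y, rfl⟩ | ⟨y, rfl⟩
        · by_cases hy : x = y
          · subst hy
            rw [h1, h2, hf1]
          · rw [← h1, ← h2, ← act_mul, ← act_mul, D.orth _ _ hy, act_zero, act_zero, map_zero]
        · by_cases hy : x = y
          · subst hy
            have h3 := congrArg Subtype.val (hgg x (x+1) (by omega) m)
            rw [← hf1] at h3
            have e1 : ∀ m, (eR (k := k) D M x (x+1) (by omega) m).1 = act k M (D.a x) m.1 := fun m => by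
              change act k M (D.p x (x+1)) m.1 = _
              rw [D.p_succ]
            have e2 : ∀ m, (eR (k := k) D N x (x+1) (by omega) m).1 = act k N (D.a x) m.1 := fun m => by
              change act k N (D.p x (x+1)) m.1 = _
              rw [D.p_succ]
            rw [e1, e2] at h3
            exact h3
          · rw [← h1, ← h2, ← act_mul, ← act_mul, ← D.src y, ← mul_assoc, D.orth _ _ hy, zero_mul,
              act_zero, act_zero, map_zero]
      | algebraMap r => intro m; rw [act_algebraMap, act_algebraMap, map_smul]
      | add a b _ _ ha hb => intro m; rw [act_add, act_add, map_add, ha, hb]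
      | mul a b _ _ ha hb => intro m; rw [act_mul, act_mul, hb, ha]
    refine ⟨ModuleCat.ofHom { toFun := f, map_add' := map_add f, map_smul' := fun a m => hlin a.unop m }, ?_⟩
    refine ev_ext _ _ fun x m => Subtype.ext (hf1 x m)

/-- total space -/
def Tot (N : Rep' k β) : Type := ∀ x : ℤ, N.obj.obj x

instance (N : Rep' k β) : AddCommGroup (Tot N) := inferInstanceAs (AddCommGroup (∀ x : ℤ, N.obj.obj x))

abbrev TotEnd (N : Rep' k β) := Module.End k (∀ x : ℤ, N.obj.obj x)

noncomputable def totMap (N : Rep' k β) (x y : ℤ) (h : x ≤ y) : TotEnd N :=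
  LinearMap.single k (fun x : ℤ => N.obj.obj x) y ∘ₗ res N.obj h ∘ₗ LinearMap.proj x

lemma totMap_apply (N : Rep' k β) (x y : ℤ) (h : x ≤ y) (v) :
    totMap N x y h v = Pi.single y (res N.obj h (v x)) := rfl

lemma totMap_mul (N : Rep' k β) (x y z : ℤ) (h : x ≤ y) (h' : y ≤ z) :
    totMap N y z h' * totMap N x y h = totMap N x z (h.trans h') := by
  refine LinearMap.ext fun v => ?_
  rw [Module.End.mul_apply, totMap_apply, totMap_apply, totMap_apply, Pi.single_eq_same, res_res]

lemma totMap_mul' (N : Rep' k β) (x y y' z : ℤ) (h : x ≤ y) (h' : y' ≤ z) (hy : y ≠ y') :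
    totMap N y' z h' * totMap N x y h = 0 := by
  refine LinearMap.ext fun v => ?_
  rw [Module.End.mul_apply, totMap_apply, totMap_apply, Pi.single_eq_of_ne hy.symm, map_zero]
  exact Pi.single_zero _

lemma totMap_pt (N : Rep' k β) {x y : ℤ} (h : x ≤ y) :
    pt (fun x => op (totMap N x x le_rfl)) (fun x => op (totMap N x (x+1) (by omega))) x y = op (totMap N x y h) := by
  induction y, h using Int.le_induction with
  | base => rw [pt_self]
  | succ y h ih => rw [pt_succ _ _ h, ih, ← MulOpposite.op_mul, totMap_mul]

noncomputable def totData (N : Rep' k β) (hout : ∀ x, x ∉ Finset.Icc 1 n → β x < x) :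
    LinData (TotEnd N)ᵐᵒᵖ β n where
  e x := op (totMap N x x le_rfl)
  a x := op (totMap N x (x+1) (by omega))
  idem x := by rw [← MulOpposite.op_mul, totMap_mul]
  orth x y h := by rw [← MulOpposite.op_mul, totMap_mul' _ _ _ _ _ _ _ h, MulOpposite.op_zero]
  src x := by rw [← MulOpposite.op_mul, totMap_mul]
  tgt x := by rw [← MulOpposite.op_mul, totMap_mul]
  sum := by
    rw [← Finset.op_sum, ← MulOpposite.op_one]
    congr 1
    refine LinearMap.ext fun v => ?_
    rw [LinearMap.sum_apply]
    funext y
    rw [Finset.sum_apply, Module.End.one_apply]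
    have : ∀ x, totMap N x x le_rfl v y = if x = y then v y else 0 := fun x => by
      rw [totMap_apply, res_self]
      split_ifs with h
      · subst h; exact Pi.single_eq_same _ _
      · exact Pi.single_eq_of_ne (Ne.symm h) _
    rw [Finset.sum_congr rfl (fun x _ => this x), Finset.sum_ite_eq']
    split_ifs with h
    · rfl
    · symm; rw [← res_self N.obj le_rfl (v y), res_zero N le_rfl (hout y h)]
  zero x y h hxy := by
    rw [totMap_pt N h, ← MulOpposite.op_zero]
    congr 1
    refine LinearMap.ext fun v => ?_
    rw [totMap_apply, res_zero N h hxy]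
    exact Pi.single_zero _

noncomputable abbrev totModule (N : Rep' k β) (f : A →ₐ[k] (TotEnd N)ᵐᵒᵖ) : Module Aᵐᵒᵖ (Tot N) where
  smul a v := (f a.unop).unop v
  one_smul v := by change (f (unop 1)).unop v = v; simp; rfl
  mul_smul a b v := by
    change (f (unop (a * b))).unop v = (f (unop a)).unop ((f (unop b)).unop v)
    simp
    rfl
  smul_zero a := map_zero (f a.unop).unop
  smul_add a v w := map_add (f a.unop).unop v w
  add_smul a b v := by
    change (f (unop (a + b))).unop v = (f (unop a)).unop v + (f (unop b)).unop v
    simp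
    rfl
  zero_smul v := by
    change (f (unop 0)).unop v = 0
    simp
    rfl

noncomputable def totMod (N : Rep' k β) (f : A →ₐ[k] (TotEnd N)ᵐᵒᵖ) : ModuleCat.{0} Aᵐᵒᵖ :=
  letI := totModule N f
  ModuleCat.of Aᵐᵒᵖ (Tot N)

lemma act_totMod (N : Rep' k β) (f : A →ₐ[k] (TotEnd N)ᵐᵒᵖ) (a : A) (v : ∀ x : ℤ, N.obj.obj x) :
    act k (totMod N f) a v = (f a).unop v := rfl

lemma smul_totMod (N : Rep' k β) (f : A →ₐ[k] (TotEnd N)ᵐᵒᵖ) (c : k) (v : ∀ x : ℤ, N.obj.obj x)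
    (v' : totMod N f) (h : v = v') : (c • v) = c • v' := by
  refine Eq.trans ?_ (act_algebraMap (totMod N f) c v')
  subst h
  refine Eq.trans ?_ (act_totMod N f _ v).symm
  rw [f.commutes]
  rfl

lemma phi_essSurj
    (huniv : ∀ (B : Type) [Ring B] [Algebra k B] (D' : LinData B β n), ∃ f : A →ₐ[k] B,
      (∀ x, f (D.e x) = D'.e x) ∧ (∀ x, f (D.a x) = D'.a x))
    (hout : ∀ x, x ∉ Finset.Icc 1 n → β x < x) : (phi k D).EssSurj where
  mem_essImage N := by
    obtain ⟨f, hfe, hfa⟩ := huniv _ (totData N hout)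
    have hfp : ∀ x y (h : x ≤ y), f (D.p x y) = op (totMap N x y h) := fun x y h => by
      refine Eq.trans ?_ (totMap_pt N h)
      induction y, h using Int.le_induction with
      | base => rw [LinData.p, pt_self, pt_self, hfe]; rfl
      | succ y h ih => rw [LinData.p, pt_succ _ _ h, pt_succ _ _ h, map_mul, hfa, ih]; rfl
    have hact := act_totMod N f
    have hactp : ∀ x y (h : x ≤ y) (v : ∀ x : ℤ, N.obj.obj x), act k (totMod N f) (D.p x y) v = totMap N x y h v :=
      fun x y h v => by rw [hact, hfp x y h]; rfl
    have hacte : ∀ x (v : ∀ x : ℤ, N.obj.obj x), act k (totMod N f) (D.e x) v = totMap N x x le_rfl v :=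
      fun x v => by rw [hact, hfe]; rfl
    let g : N ⟶ phiObj k D (totMod N f) := mkH (M := N) (N := phiObj k D (totMod N f)) (fun x =>
      ({ toFun m := ⟨(Pi.single x m : ∀ x : ℤ, N.obj.obj x), by
           refine (mem_eS _ _ _ _).2 ?_
           refine (hacte _ _).trans ?_
           rw [totMap_apply, Pi.single_eq_same, res_self]⟩
         map_add' p q := Subtype.ext (Pi.single_add _ _ _)
         map_smul' c p := Subtype.ext ((Pi.single_smul x c p).trans (smul_totMod N f c _ _ rfl)) } : N.obj.obj x →ₗ[k] eS k D (totMod N f) x))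
      (fun x y h m => Subtype.ext (by
        refine Eq.trans ?_ (hactp x y h (Pi.single x m)).symm
        rw [totMap_apply, Pi.single_eq_same]
        rfl))
    have : IsIso g := isIso_of_ev _ (fun x => by
      constructor
      · intro m m' h
        exact Pi.single_injective (M := fun x : ℤ => N.obj.obj x) x (congrArg Subtype.val h)
      · intro (v : eS k D (totMod N f) x)
        let v' : ∀ x : ℤ, N.obj.obj x := v.1
        refine ⟨v' x, Subtype.ext ?_⟩
        refine Eq.trans ?_ v.2
        refine Eq.trans ?_ (hacte x v').symm
        rw [totMap_apply, res_self]
        rfl)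
    exact ⟨totMod N f, ⟨(asIso g).symm⟩⟩

theorem phi_equiv
    (hgen : Algebra.adjoin k (Set.range D.e ∪ Set.range D.a) = ⊤)
    (huniv : ∀ (B : Type) [Ring B] [Algebra k B] (D' : LinData B β n), ∃ f : A →ₐ[k] B,
      (∀ x, f (D.e x) = D'.e x) ∧ (∀ x, f (D.a x) = D'.a x))
    (hout : ∀ x, x ∉ Finset.Icc 1 n → β x < x) : Nonempty (ModuleCat.{0} Aᵐᵒᵖ ≌ Rep' k β) := by
  have := phi_full D hgen hout
  have := phi_essSurj D huniv hout
  have : (phi k D).IsEquivalence := {}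
  exact ⟨(phi k D).asEquivalence⟩
end
end

section
open CategoryTheory Limits

section
/-- the combinatorial zero condition -/
def PZ (n : ℤ) {t : ℕ} (ns ls : Fin t → ℕ) (x y : ℤ) : Prop :=
  x < 1 ∨ n < y ∨ ∃ i, x ≤ ns i ∧ (ns i : ℤ) + ls i ≤ y

lemma exists_beta (n : ℤ) {t : ℕ} (ns ls : Fin t → ℕ) :
    ∃ β : ℤ → ℤ, ∀ x, x - 1 ≤ β x ∧ ∀ y, x ≤ y → (β x < y ↔ PZ n ns ls x y) := by
  have : ∀ x : ℤ, ∃ b : ℤ, x - 1 ≤ b ∧ ∀ y, x ≤ y → (b < y ↔ PZ n ns ls x y) := fun x => by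
    obtain ⟨b, ⟨h1, h2⟩, h3⟩ := Int.exists_least_of_bdd (P := fun z => x ≤ z ∧ PZ n ns ls x z)
      ⟨x, fun z hz => hz.1⟩ ⟨max x (n+1), le_max_left _ _, Or.inr (Or.inl (by omega))⟩
    refine ⟨b - 1, by omega, fun y hy => ⟨fun h => ?_, fun h => ?_⟩⟩
    · rcases h2 with h2 | h2 | ⟨i, hi, hi'⟩
      · exact Or.inl h2
      · exact Or.inr (Or.inl (by omega))
      · exact Or.inr (Or.inr ⟨i, hi, by omega⟩)
    · have := h3 y ⟨hy, h⟩
      omega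
  choose β h using this
  exact ⟨β, h⟩

lemma beta_mono {n : ℤ} {t : ℕ} {ns ls : Fin t → ℕ} {β : ℤ → ℤ}
    (h : ∀ x, x - 1 ≤ β x ∧ ∀ y, x ≤ y → (β x < y ↔ PZ n ns ls x y)) : Monotone β := by
  intro x x' hx
  by_contra hlt
  have h1 := (h x').1
  have h2 := ((h x').2 (β x) (by omega)).1 (by omega)
  have h3 : PZ n ns ls x (β x) := by
    rcases h2 with h2 | h2 | ⟨i, hi, hi'⟩
    · exact Or.inl (by omega)
    · exact Or.inr (Or.inl h2)
    · exact Or.inr (Or.inr ⟨i, by omega, hi'⟩)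
  have := ((h x).2 (β x) (by omega)).2 h3
  omega

lemma exists_adj {β : ℤ → ℤ} (hm : Monotone β) (hle : ∀ x, x - 1 ≤ β x) (hlow : ∀ x < 1, β x < x) :
    ∃ a : ℤ → ℤ, ∀ u x, u ≤ β x ↔ a u ≤ x := by
  have : ∀ u : ℤ, ∃ a : ℤ, ∀ x, u ≤ β x ↔ a ≤ x := fun u => by
    obtain ⟨a, h1, h2⟩ := Int.exists_least_of_bdd (P := fun x => u ≤ β x)
      ⟨min 1 u, fun z hz => by
        by_cases h : z < 1
        · have := hlow z h; omega
        · omega⟩ ⟨u + 1, by have := hle (u+1); omega⟩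
    exact ⟨a, fun x => ⟨h2 x, fun h => h1.trans (hm h)⟩⟩
  choose a h using this
  exact ⟨a, h⟩

lemma exists_comb (n t : ℕ) (ns ls : Fin (t + 1) → ℕ) (h : IsASNakayama n (t + 1) ns ls)
    (i0 : Fin (t + 1)) (h2 : ls i0 = 2) : ∃ c : Comb,
    (∀ x y, x ≤ y → (c.β x < y ↔ PZ n (ns ∘ i0.succAbove) (ls ∘ i0.succAbove) x y)) ∧
    (∀ x y, x ≤ y → (c.βA x < y ↔ PZ n ns ls x y)) := by
  obtain ⟨β, hβ⟩ := exists_beta n (ns ∘ i0.succAbove) (ls ∘ i0.succAbove)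
  have hm := beta_mono hβ
  have hlow : ∀ x < 1, β x < x := fun x hx => ((hβ x).2 x le_rfl).2 (Or.inl hx)
  obtain ⟨a, ha⟩ := exists_adj hm (fun x => (hβ x).1) hlow
  have e1 := h.end_le i0
  have e2 := h.one_le i0
  let c : Comb :=
    { β := β, a := a, w := ns i0 + 1, n := n, mono := hm, gc := ha, le := fun x => (hβ x).1
      low := hlow
      hi := fun x hx => ((hβ x).2 x le_rfl).2 (Or.inr (Or.inl hx))
      hw := by
        by_contra hlt
        rcases ((hβ (ns i0 + 1)).2 (ns i0 + 1) le_rfl).1 (by omega) with h3 | h3 | ⟨i, hi, hi'⟩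
        · omega
        · omega
        · have := h.two_le (i0.succAbove i)
          simp only [Function.comp] at hi hi'
          omega
      split := by
        intro x hx
        by_contra hc
        have hc1 : ¬ PZ n (ns ∘ i0.succAbove) (ls ∘ i0.succAbove) x (ns i0 + 1) := fun h3 => by
          have := ((hβ x).2 _ hx).2 h3
          omega
        have hc2 := hm hx
        have hc3 : ¬ PZ n (ns ∘ i0.succAbove) (ls ∘ i0.succAbove) (ns i0 + 1) (β (ns i0 + 1)) := fun h3 => by
          have := ((hβ (ns i0 + 1)).2 _ (by omega)).2 h3
          omega
        rcases ((hβ x).2 (β (ns i0 + 1)) (by omega)).1 (by omega) with h3 | h3 | ⟨i, hi, hi'⟩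
        · exact hc1 (Or.inl h3)
        · exact hc3 (Or.inr (Or.inl h3))
        · simp only [Function.comp] at hi hi'
          rcases lt_or_gt_of_ne (Fin.succAbove_ne i0 i) with h4 | h4
          · have := h.almost_separate _ _ h4
            exact hc1 (Or.inr (Or.inr ⟨i, hi, by simp only [Function.comp]; omega⟩))
          · have := h.almost_separate _ _ h4
            exact hc3 (Or.inr (Or.inr ⟨i, by simp only [Function.comp]; omega, hi'⟩)) }
  refine ⟨c, fun x => (hβ x).2, fun x y hxy => ?_⟩
  have key : PZ n ns ls x y ↔ PZ n (ns ∘ i0.succAbove) (ls ∘ i0.succAbove) x y ∨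
      (x < (ns i0 : ℤ) + 1 ∧ (ns i0 : ℤ) + 1 < y) := by
    constructor
    · rintro (h3 | h3 | ⟨i, hi, hi'⟩)
      · exact Or.inl (Or.inl h3)
      · exact Or.inl (Or.inr (Or.inl h3))
      · rcases Fin.eq_self_or_eq_succAbove i0 i with h4 | ⟨j, rfl⟩
        · subst h4
          right; omega
        · exact Or.inl (Or.inr (Or.inr ⟨j, hi, hi'⟩))
    · rintro ((h3 | h3 | ⟨i, hi, hi'⟩) | h3)
      · exact Or.inl h3
      · exact Or.inr (Or.inl h3)
      · exact Or.inr (Or.inr ⟨_, hi, hi'⟩)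
      · exact Or.inr (Or.inr ⟨i0, by omega, by omega⟩)
  rw [key, ← (hβ x).2 y hxy]
  change (if x < (ns i0 : ℤ) + 1 then min (β x) (ns i0 + 1) else β x) < y ↔ _
  split_ifs <;> omega
end

section
variable {k : Type} [Field k] {B : Type} [Ring B] [Algebra k B]

lemma linPath_succ (n v l : ℕ) (h : v - 1 + l < n - 1) :
    linPath n v (l + 1) = linPath n v l ++ ([(⟨v - 1 + l, h⟩ : Fin (n-1))] : List (linQuiver n).A) := by
  unfold linPath
  rw [List.range_succ, List.filterMap_append]
  congr 1
  exact (List.filterMap_cons_some (dif_pos h)).trans rfl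

/-- a function of integers evaluated at arrows -/
def arrF (n : ℕ) (a : ℤ → B) (j : (linQuiver n).A) : B := a (Fin.val (n := n-1) j + 1)

lemma linPath_prod (e a : ℤ → B) (hsrc : ∀ x, e x * a x = a x) (n v l : ℕ) (hv : 1 ≤ v) (hl : 1 ≤ l)
    (h : v + l ≤ n) : ((linPath n v l).map (arrF n a)).prod = pth e a v l := by
  induction l, hl using Nat.le_induction with
  | base =>
    rw [linPath_succ n v 0 (by omega)]
    have : linPath n v 0 = [] := rfl
    rw [this]
    have e : (((v - 1 + 0 : ℕ) : ℤ) + 1) = (v : ℤ) := by omega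
    simp only [List.nil_append, List.map_cons, List.map_nil, List.prod_singleton, pth]
    refine Eq.trans (b := a v) (List.prod_singleton.trans (congrArg a e)) ?_
    simp [hsrc]
  | succ l hl ih =>
    rw [linPath_succ n v l (by omega), List.map_append, List.prod_append, ih (by omega), pth]
    have e : (((v - 1 + l : ℕ) : ℤ) + 1) = (v : ℤ) + l := by omega
    exact congrArg (fun z => pth _ a v l * z) (List.prod_singleton.trans (congrArg a e))

lemma pt_e' (e a : ℤ → B) (hid : ∀ x, e x * e x = e x) (htgt : ∀ x, a x * e (x+1) = a x)
    {x y : ℤ} (h : x ≤ y) : pt e a x y * e y = pt e a x y := by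
  induction y, h using Int.le_induction with
  | base => rw [pt_self, hid]
  | succ y h ih => rw [pt_succ _ _ h, mul_assoc, htgt]

lemma pt_pt' (e a : ℤ → B) (hid : ∀ x, e x * e x = e x) (htgt : ∀ x, a x * e (x+1) = a x)
    {x y z : ℤ} (h : x ≤ y) (h' : y ≤ z) : pt e a x y * pt e a y z = pt e a x z := by
  induction z, h' using Int.le_induction with
  | base => rw [pt_self, pt_e' e a hid htgt h]
  | succ z h' ih => rw [pt_succ _ _ h', ← mul_assoc, ih, pt_succ _ _ (h.trans h')]

variable (k) in
noncomputable def gE (n : ℕ) (v : (linQuiver n).V) : FreeAlgebra k ((linQuiver n).V ⊕ (linQuiver n).A) :=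
  FreeAlgebra.ι k (Sum.inl v)

variable (k) in
noncomputable def gA (n : ℕ) (v : (linQuiver n).A) : FreeAlgebra k ((linQuiver n).V ⊕ (linQuiver n).A) :=
  FreeAlgebra.ι k (Sum.inr v)

variable (k) in
noncomputable def qe (n t : ℕ) (ns ls : Fin t → ℕ) (x : ℤ) : NakayamaAlgebra k n t ns ls :=
  if h : 1 ≤ x ∧ x ≤ n then RingQuot.mkAlgHom k _ (gE k n (⟨(x-1).toNat, by omega⟩ : Fin n)) else 0

variable (k) in
noncomputable def qa (n t : ℕ) (ns ls : Fin t → ℕ) (x : ℤ) : NakayamaAlgebra k n t ns ls :=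
  if h : 1 ≤ x ∧ x ≤ n - 1 then
    RingQuot.mkAlgHom k _ (gA k n (⟨(x-1).toNat, by omega⟩ : Fin (n-1))) else 0

lemma qe_fin (n t : ℕ) (ns ls : Fin t → ℕ) (v : Fin n) :
    qe k n t ns ls (v.1 + 1) = RingQuot.mkAlgHom k _ (gE k n v) := by
  unfold qe
  rw [dif_pos (by have := v.2; omega)]
  congr 2
  apply Fin.ext
  simp

lemma qa_fin (n t : ℕ) (ns ls : Fin t → ℕ) (v : Fin (n-1)) :
    qa k n t ns ls (v.1 + 1) = RingQuot.mkAlgHom k _ (gA k n v) := by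
  unfold qa
  rw [dif_pos (by have := v.2; omega)]
  congr 2
  apply Fin.ext
  simp

lemma qe_out (n t : ℕ) (ns ls : Fin t → ℕ) (x : ℤ) (h : ¬ (1 ≤ x ∧ x ≤ n)) : qe k n t ns ls x = 0 := dif_neg h
lemma qa_out (n t : ℕ) (ns ls : Fin t → ℕ) (x : ℤ) (h : ¬ (1 ≤ x ∧ x ≤ n - 1)) : qa k n t ns ls x = 0 := dif_neg h

lemma fin_cases_e {n : ℕ} {x : ℤ} (h : 1 ≤ x ∧ x ≤ n) : ∃ v : Fin n, x = v.1 + 1 :=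
  ⟨⟨(x-1).toNat, by omega⟩, by simp; omega⟩

lemma fin_cases_a {n : ℕ} {x : ℤ} (h : 1 ≤ x ∧ x ≤ n - 1) : ∃ v : Fin (n-1), x = v.1 + 1 :=
  ⟨⟨(x-1).toNat, by omega⟩, by simp; omega⟩

lemma sum_Icc_fin {M : Type} [AddCommMonoid M] (n : ℕ) (f : ℤ → M) :
    ∑ x ∈ Finset.Icc (1 : ℤ) n, f x = ∑ v : Fin n, f (v.1 + 1) := by
  symm
  refine Finset.sum_bij (fun v _ => (v.1 : ℤ) + 1) ?_ ?_ ?_ ?_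
  · intro v _; have := v.2; simp only [Finset.mem_Icc]; omega
  · intro v _ v' _ h; apply Fin.ext; omega
  · intro x hx
    obtain ⟨v, hv⟩ := fin_cases_e (Finset.mem_Icc.1 hx)
    exact ⟨v, Finset.mem_univ _, hv.symm⟩
  · intro v _; rfl

variable {n t : ℕ} {ns ls : Fin t → ℕ}

lemma q_rel {x y} (h : PathAlgRel k (linQuiver n) {p | ∃ i : Fin t, p = linPath n (ns i) (ls i)} x y) :
    RingQuot.mkAlgHom k (PathAlgRel k (linQuiver n) {p | ∃ i : Fin t, p = linPath n (ns i) (ls i)}) x =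
    RingQuot.mkAlgHom k _ y := RingQuot.mkAlgHom_rel k h

lemma qe_idem (x : ℤ) : qe k n t ns ls x * qe k n t ns ls x = qe k n t ns ls x := by
  by_cases h : 1 ≤ x ∧ x ≤ n
  · obtain ⟨v, rfl⟩ := fin_cases_e h
    rw [qe_fin, ← map_mul]
    exact q_rel (PathAlgRel.idem (Q := linQuiver n) v)
  · rw [qe_out _ _ _ _ _ h, mul_zero]

lemma qa_src (x : ℤ) : qe k n t ns ls x * qa k n t ns ls x = qa k n t ns ls x := by
  by_cases h : 1 ≤ x ∧ x ≤ n - 1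
  · obtain ⟨v, rfl⟩ := fin_cases_a h
    have := qe_fin (k := k) n t ns ls ⟨v.1, by omega⟩
    dsimp only at this
    rw [qa_fin, this, ← map_mul]
    exact q_rel (PathAlgRel.source (Q := linQuiver n) v)
  · rw [qa_out _ _ _ _ _ h, mul_zero]

lemma qa_tgt (x : ℤ) : qa k n t ns ls x * qe k n t ns ls (x + 1) = qa k n t ns ls x := by
  by_cases h : 1 ≤ x ∧ x ≤ n - 1
  · obtain ⟨v, rfl⟩ := fin_cases_a h
    have := qe_fin (k := k) n t ns ls ⟨v.1 + 1, by omega⟩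
    push_cast at this
    rw [qa_fin, this, ← map_mul]
    exact q_rel (PathAlgRel.target (Q := linQuiver n) v)
  · rw [qa_out _ _ _ _ _ h, zero_mul]

lemma pt_nat (e a : ℤ → B) (v l : ℕ) : pt e a v (v + l) = pth e a v l := by
  unfold pt; congr; omega

variable (k) in
noncomputable def qD (h1 : ∀ i, 1 ≤ ns i) (hl : ∀ i, 1 ≤ ls i) (hn : ∀ i, ns i + ls i ≤ n)
    (β : ℤ → ℤ) (hβ : ∀ x y, x ≤ y → (β x < y ↔ PZ n ns ls x y)) :
    LinData (NakayamaAlgebra k n t ns ls) β n where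
  e := qe k n t ns ls
  a := qa k n t ns ls
  idem := qe_idem
  src := qa_src
  tgt := qa_tgt
  orth x y hxy := by
    by_cases h : 1 ≤ x ∧ x ≤ n
    · by_cases h' : 1 ≤ y ∧ y ≤ n
      · obtain ⟨v, rfl⟩ := fin_cases_e h
        obtain ⟨v', rfl⟩ := fin_cases_e h'
        rw [qe_fin, qe_fin, ← map_mul, ← map_zero (RingQuot.mkAlgHom k _)]
        exact q_rel (PathAlgRel.orth (Q := linQuiver n) v v' (by rintro rfl; exact hxy rfl))
      · rw [qe_out _ _ _ _ y h', mul_zero]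
    · rw [qe_out _ _ _ _ x h, zero_mul]
  sum := by
    rw [sum_Icc_fin]
    have h := q_rel (k := k) (ns := ns) (ls := ls) (PathAlgRel.unit (Q := linQuiver n))
    rw [map_one, map_sum] at h
    exact (Finset.sum_congr rfl (fun v _ => qe_fin n t ns ls v)).trans h
  zero x y hxy h := by
    have hpp := @pt_pt' (NakayamaAlgebra k n t ns ls) _ (qe k n t ns ls) (qa k n t ns ls) qe_idem qa_tgt
    rcases (hβ x y hxy).1 h with h | h | ⟨i, hi, hi'⟩
    · rw [← hpp le_rfl hxy, pt_self, qe_out _ _ _ _ _ (by omega), zero_mul]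
    · rw [← hpp hxy le_rfl, pt_self, qe_out _ _ _ _ _ (by omega), mul_zero]
    · have h3 : pt (qe k n t ns ls) (qa k n t ns ls) (ns i) (ns i + ls i) = 0 := by
        rw [pt_nat, ← linPath_prod _ _ qa_src n (ns i) (ls i) (h1 i) (hl i) (hn i)]
        have := q_rel (k := k) (n := n) (ns := ns) (ls := ls) (PathAlgRel.zeroRel _ ⟨i, rfl⟩)
        rw [map_zero, map_list_prod, List.map_map] at this
        refine Eq.trans ?_ this
        congr 2
        funext v
        exact qa_fin n t ns ls v
      rw [← hpp hi (by omega : (ns i : ℤ) ≤ y), ← hpp (by omega : (ns i : ℤ) ≤ ns i + ls i) hi', h3, zero_mul, mul_zero]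

lemma q_gen : Algebra.adjoin k (Set.range (qe k n t ns ls) ∪ Set.range (qa k n t ns ls)) = ⊤ := by
  rw [eq_top_iff]
  have h := FreeAlgebra.adjoin_range_ι k (X := (linQuiver n).V ⊕ (linQuiver n).A)
  have h2 := congrArg (Subalgebra.map (RingQuot.mkAlgHom k
    (PathAlgRel k (linQuiver n) {p | ∃ i : Fin t, p = linPath n (ns i) (ls i)}))) h
  have h3 : Subalgebra.map (RingQuot.mkAlgHom k
    (PathAlgRel k (linQuiver n) {p | ∃ i : Fin t, p = linPath n (ns i) (ls i)})) ⊤ = ⊤ := by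
    rw [Algebra.map_top, AlgHom.range_eq_top]
    exact RingQuot.mkAlgHom_surjective k _
  refine (h3.symm.le.trans h2.symm.le).trans ?_
  rw [AlgHom.map_adjoin]
  apply Algebra.adjoin_mono
  rintro _ ⟨_, ⟨v | v, rfl⟩, rfl⟩
  · exact Or.inl ⟨_, qe_fin n t ns ls v⟩
  · exact Or.inr ⟨_, qa_fin n t ns ls v⟩

lemma q_univ (h1 : ∀ i, 1 ≤ ns i) (hl : ∀ i, 1 ≤ ls i) (hn : ∀ i, ns i + ls i ≤ n)
    (β : ℤ → ℤ) (hβ : ∀ x y, x ≤ y → (β x < y ↔ PZ n ns ls x y)) (D : LinData B β n) :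
    ∃ f : NakayamaAlgebra k n t ns ls →ₐ[k] B,
      (∀ x, f (qe k n t ns ls x) = D.e x) ∧ (∀ x, f (qa k n t ns ls x) = D.a x) := by
  have hlow : ∀ x < 1, D.e x = 0 := fun x hx => D.e_zero ((hβ x x le_rfl).2 (Or.inl hx))
  have hhi : ∀ x : ℤ, n < x → D.e x = 0 := fun x hx => D.e_zero ((hβ x x le_rfl).2 (Or.inr (Or.inl hx)))
  let g : FreeAlgebra k ((linQuiver n).V ⊕ (linQuiver n).A) →ₐ[k] B := FreeAlgebra.lift k
    (Sum.elim (fun v => D.e (Fin.val (n := n) v + 1)) (fun v => D.a (Fin.val (n := n-1) v + 1)))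
  have ge : ∀ v : Fin n, g (gE k n v) = D.e (v.1 + 1) := fun v =>
    FreeAlgebra.lift_ι_apply _ _
  have ga : ∀ v : Fin (n-1), g (gA k n v) = D.a (v.1 + 1) := fun v =>
    FreeAlgebra.lift_ι_apply _ _
  have hg : ∀ x y, PathAlgRel k (linQuiver n) {p | ∃ i : Fin t, p = linPath n (ns i) (ls i)} x y → g x = g y := by
    intro x y hxy
    cases hxy with
    | idem v =>
      rw [map_mul]
      refine (congrArg (fun z => z * z) (ge v)).trans ((D.idem _).trans (ge v).symm)
    | orth v w hvw =>
      rw [map_mul, map_zero]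
      refine (congrArg₂ (fun z w => z * w) (ge v) (ge w)).trans (D.orth _ _ ?_)
      intro h
      exact hvw (Fin.ext (by omega))
    | unit =>
      rw [map_one, map_sum, ← D.sum, sum_Icc_fin]
      exact Finset.sum_congr rfl (fun v _ => ge v)
    | source v =>
      rw [map_mul]
      exact (congrArg₂ (fun z w => z * w) (ge _) (ga v)).trans ((D.src _).trans (ga v).symm)
    | target v =>
      rw [map_mul]
      refine (congrArg₂ (fun z w => z * w) (ga v) (ge _)).trans (Eq.trans ?_ (ga v).symm)
      have := D.tgt (v.1 + 1)
      exact this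
    | zeroRel p hp =>
      obtain ⟨i, rfl⟩ := hp
      rw [map_zero, map_list_prod, List.map_map]
      refine Eq.trans ?_ (D.zero (ns i) (ns i + ls i) (by omega)
        ((hβ _ _ (by omega)).2 (Or.inr (Or.inr ⟨i, le_rfl, le_rfl⟩))))
      rw [pt_nat, ← linPath_prod _ _ D.src n (ns i) (ls i) (h1 i) (hl i) (hn i)]
      congr 2
      funext v
      exact ga v
  refine ⟨RingQuot.liftAlgHom k ⟨g, fun {x y} h => hg x y h⟩, fun x => ?_, fun x => ?_⟩
  · by_cases h : 1 ≤ x ∧ x ≤ n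
    · obtain ⟨v, rfl⟩ := fin_cases_e h
      rw [qe_fin]
      exact (RingQuot.liftAlgHom_mkAlgHom_apply k _ _ _).trans (ge v)
    · rw [qe_out _ _ _ _ x h, map_zero]
      by_cases h' : x < 1
      · rw [hlow x h']
      · rw [hhi x (by omega)]
  · by_cases h : 1 ≤ x ∧ x ≤ n - 1
    · obtain ⟨v, rfl⟩ := fin_cases_a h
      rw [qa_fin]
      exact (RingQuot.liftAlgHom_mkAlgHom_apply k _ _ _).trans (ga v)
    · rw [qa_out _ _ _ _ x h, map_zero]
      by_cases h' : x < 1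
      · rw [← D.src x, hlow x h', zero_mul]
      · rw [← D.tgt x, hhi (x+1) (by omega), mul_zero]

variable (k) in
theorem nakayama_equiv (h1 : ∀ i, 1 ≤ ns i) (hl : ∀ i, 1 ≤ ls i) (hn : ∀ i, ns i + ls i ≤ n)
    (β : ℤ → ℤ) (hβ : ∀ x y, x ≤ y → (β x < y ↔ PZ n ns ls x y)) :
    Nonempty (ModuleCat.{0} (NakayamaAlgebra k n t ns ls)ᵐᵒᵖ ≌ Rep' k β) := by
  refine phi_equiv (n := n) (qD k h1 hl hn β hβ) q_gen
    (fun B _ _ D => q_univ h1 hl hn β hβ D) (fun x hx => ?_)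
  refine (hβ x x le_rfl).2 ?_
  by_cases h : x < 1
  · exact Or.inl h
  · refine Or.inr (Or.inl ?_)
    by_contra h'
    exact hx (Finset.mem_Icc.2 ⟨by omega, by omega⟩)
end
end

/-- **Corollary 4.4.** If a linear Nakayama algebra with almost separate
relations has a relation of length `2`, then deleting this relation does not change the
derived equivalence class (when it is the only relation, the resulting algebra is the
hereditary path algebra `kA_n`). -/
theorem nakayama_delete_length_two (k : Type) [Field k] (n t : ℕ)
    (ns ls : Fin (t + 1) → ℕ) (h : IsASNakayama n (t + 1) ns ls)
    (i0 : Fin (t + 1)) (h2 : ls i0 = 2) :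
    DerivedEquivalent k (NakayamaAlgebra k n (t + 1) ns ls)
      (NakayamaAlgebra k n t (ns ∘ i0.succAbove) (ls ∘ i0.succAbove)) := by
  obtain ⟨c, hB, hA⟩ := exists_comb n t ns ls h i0 h2
  obtain ⟨eA⟩ := nakayama_equiv k h.one_le (fun i => (by norm_num : 1 ≤ 2).trans (h.two_le i)) h.end_le c.βA hA
  obtain ⟨eB⟩ := nakayama_equiv k (fun i => h.one_le (i0.succAbove i))
    (fun i => (by norm_num : 1 ≤ 2).trans (h.two_le (i0.succAbove i)))
    (fun i => h.end_le (i0.succAbove i)) c.β hB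
  exact ((TriEq.ofEquiv eA).trans (triEq_comb k c)).trans (TriEq.ofEquiv eB.symm)
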